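/- arXiv:1012.2718 — 3 statements merged into one kernel-verified Lean document; each statement's English description precedes it below -/
import Mathlib

section
/- For every h : D → ℝ with boundary conditions h(±∞, y) = ±1 (h in m + H¹(D)), one has ∫_D [½|∇h|² + F(h)] dz ≥ C*, with equality if and only if ∇_y h ≡ 0 and ∂_x h = √(2F(h)); consequently the set of minimizers of the free energy under these boundary conditions is exactly M = { m_ξ : ξ ∈ ℝ }, where m_ξ(x,y) = m(x − ξ). -/
open MeasureTheory Real Filter Topology
open scoped ENNReal RealInnerProductSpace

noncomputable section

/-- `Eucl d` is the Euclidean space `ℝ^(d+1)`. -/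
abbrev Eucl (d : ℕ) : Type := EuclideanSpace ℝ (Fin (d + 1))

/-- The unbounded domain `D = ℝ × (0,1)^d`, as a subset of `ℝ^(d+1)`. -/
def domD (d : ℕ) : Set (Eucl d) := {z | ∀ i : Fin d, z i.succ ∈ Set.Ioo (0 : ℝ) 1}

/-- The bounded domain `D_L = (-L,L) × (0,1)^d`. -/
def domDL (d : ℕ) (L : ℝ) : Set (Eucl d) :=
  {z | |z 0| < L ∧ ∀ i : Fin d, z i.succ ∈ Set.Ioo (0 : ℝ) 1}

/-- The standing assumptions on the symmetric double well potential `F`. -/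
structure IsStdPotential (F : ℝ → ℝ) : Prop where
  smooth : ContDiff ℝ 3 F
  symm : ∀ u, F (-u) = F u
  nonneg : ∀ u, 0 ≤ F u
  zero_iff : ∀ u, F u = 0 ↔ u = 1 ∨ u = -1
  deriv_zero_iff : ∀ u, deriv F u = 0 ↔ u = 0 ∨ u = 1 ∨ u = -1
  dd_zero_neg : deriv (deriv F) 0 < 0
  dd_one_pos : 0 < deriv (deriv F) 1
  dd_neg_one_pos : 0 < deriv (deriv F) (-1)

/-- The surface tension `C* = ∫_{-1}^1 √(2 F(u)) du`. -/
def Cstar (F : ℝ → ℝ) : ℝ := ∫ u in (-1 : ℝ)..1, Real.sqrt (2 * F u)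

/-- `m` is the optimal transition profile for the potential `F`: a solution of
`m' = √(2F(m))`, `m(±∞) = ±1`, `m(0) = 0`, with values in `[-1,1]`. -/
structure IsProfile (F m : ℝ → ℝ) : Prop where
  mem_Icc : ∀ x, m x ∈ Set.Icc (-1 : ℝ) 1
  ode : ∀ x, HasDerivAt m (Real.sqrt (2 * F (m x))) x
  limit_top : Tendsto m atTop (nhds 1)
  limit_bot : Tendsto m atBot (nhds (-1))
  zero : m 0 = 0

/-- Boundary conditions `h(±∞, y) = ±1`: along every line in the `x`-direction through the
domain, `h` tends to `±1`. -/
def BCpm (d : ℕ) (h : Eucl d → ℝ) : Prop :=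
  ∀ z ∈ domD d,
    Tendsto (fun t : ℝ => h (z + t • EuclideanSpace.single 0 1)) atTop (nhds 1) ∧
    Tendsto (fun t : ℝ => h (z + t • EuclideanSpace.single 0 1)) atBot (nhds (-1))


theorem IsStdPotential.continuous_sqrt {F : ℝ → ℝ} (hF : IsStdPotential F) :
    Continuous fun u => √(2 * F u) :=
  (continuous_const.mul hF.smooth.continuous).sqrt

theorem IsStdPotential.sq_sqrt {F : ℝ → ℝ} (hF : IsStdPotential F) (u : ℝ) :
    √(2 * F u) ^ 2 = 2 * F u :=
  Real.sq_sqrt (mul_nonneg zero_le_two (hF.nonneg u))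

/-- A nonnegative `C²` function satisfies `F'² ≤ C F` on compact sets. -/
theorem exists_deriv_sq_le_mul {F : ℝ → ℝ} (hsm : ContDiff ℝ 2 F) (hnn : ∀ u, 0 ≤ F u) :
    ∃ C, 0 ≤ C ∧ ∀ u ∈ Set.Icc (-1 : ℝ) 1, deriv F u ^ 2 ≤ C * F u := by
  have hd : ContDiff ℝ 1 (deriv F) := hsm.deriv'
  have hdd : Continuous (deriv (deriv F)) := hd.continuous_deriv le_rfl
  have hF1 : Differentiable ℝ F := hsm.differentiable (by norm_num)
  obtain ⟨M, hM⟩ := (isCompact_Icc (a := (-2 : ℝ)) (b := 2)).exists_bound_of_continuousOn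
    hdd.continuousOn
  obtain ⟨B, hB⟩ := (isCompact_Icc (a := (-1 : ℝ)) (b := 1)).exists_bound_of_continuousOn
    hd.continuous.continuousOn
  set K := max (max M B) 1 with hK
  have hMK : M ≤ K := (le_max_left _ _).trans (le_max_left _ _)
  have hBK : B ≤ K := (le_max_right _ _).trans (le_max_left _ _)
  have hK1 : 1 ≤ K := le_max_right _ _
  have hK0 : 0 < K := by linarith
  refine ⟨4 * K, by linarith, fun u hu => ?_⟩
  set s := -deriv F u / (2 * K) with hs
  have hs1 : |s| ≤ 1 := by
    have h1 := hB u hu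
    rw [Real.norm_eq_abs] at h1
    rw [hs, abs_div, abs_neg, abs_of_pos (by linarith : 0 < 2 * K), div_le_one (by linarith)]
    linarith
  have hlip : ∀ c ∈ Set.uIcc u (u + s), |deriv F c - deriv F u| ≤ K * |s| := by
    intro c hc
    have hc' : |c - u| ≤ |s| := by simpa using Set.abs_sub_left_of_mem_uIcc hc
    have h2 := (convex_Icc (-2 : ℝ) 2).norm_image_sub_le_of_norm_deriv_le (f := deriv F)
      (fun x _ => (hd.differentiable one_ne_zero) x) hM (x := u) (y := c)
      ⟨by linarith [hu.1], by linarith [hu.2]⟩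
      ⟨by linarith [hu.1, (abs_le.1 (hc'.trans hs1)).1],
        by linarith [hu.2, (abs_le.1 (hc'.trans hs1)).2]⟩
    simp only [Real.norm_eq_abs] at h2
    calc _ ≤ M * |c - u| := h2
      _ ≤ K * |c - u| := by gcongr
      _ ≤ K * |s| := by gcongr
  have h3 := (convex_uIcc u (u + s)).norm_image_sub_le_of_norm_deriv_le
    (f := fun c => F c - deriv F u * c) (C := K * |s|)
    (fun x _ => (hF1 x).sub ((differentiableAt_id).const_mul _))
    (fun x hx => by
      have : deriv (fun c => F c - deriv F u * c) x = deriv F x - deriv F u := by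
        have h := (hF1 x).hasDerivAt.sub ((hasDerivAt_id x).const_mul (deriv F u))
        rw [mul_one] at h
        exact h.deriv
      rw [this]
      exact hlip x hx) (Set.left_mem_uIcc) (Set.right_mem_uIcc)
  simp only [Real.norm_eq_abs, add_sub_cancel_left] at h3
  have h4 := (abs_le.1 h3).2
  have h5 := hnn (u + s)
  have h6 : K * |s| * |s| = K * s ^ 2 := by rw [mul_assoc, abs_mul_abs_self]; ring
  rw [h6] at h4
  have h7 : 0 ≤ F u + deriv F u * s + K * s ^ 2 := by linarith
  have h8 : F u + deriv F u * s + K * s ^ 2 = F u - deriv F u ^ 2 / (4 * K) := by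
    rw [hs]; field_simp; ring
  rw [h8, sub_nonneg, div_le_iff₀ (by linarith)] at h7
  linarith

theorem IsStdPotential.exists_lipschitzOnWith_sqrt {F : ℝ → ℝ} (hF : IsStdPotential F) :
    ∃ K, LipschitzOnWith K (fun u => √(2 * F u)) (Set.Icc (-1) 1) := by
  obtain ⟨C, hC, hCF⟩ := exists_deriv_sq_le_mul
    (hF.smooth.of_le (by norm_num)) hF.nonneg
  refine ⟨(√C).toNNReal, ?_⟩
  rw [← closure_Ioo (by norm_num : (-1 : ℝ) ≠ 1)]
  refine LipschitzOnWith.closure hF.continuous_sqrt.continuousOn ?_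
  have hpos : ∀ x ∈ Set.Ioo (-1 : ℝ) 1, 0 < F x := fun x hx =>
    (hF.nonneg x).lt_of_ne' fun h0 => by
      rcases (hF.zero_iff x).1 h0 with h | h
      · exact hx.2.ne h
      · exact hx.1.ne' h
  refine (convex_Ioo (-1 : ℝ) 1).lipschitzOnWith_of_nnnorm_hasDerivWithin_le
    (f' := fun x => 2 * deriv F x / (2 * √(2 * F x))) (fun x hx => ?_) (fun x hx => ?_)
  · have h1 : HasDerivAt F (deriv F x) x :=
      (hF.smooth.differentiable (by norm_num) x).hasDerivAt
    exact ((h1.const_mul 2).sqrt (by have := hpos x hx; positivity)).hasDerivWithinAt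
  · rw [← NNReal.coe_le_coe, Real.coe_toNNReal _ (Real.sqrt_nonneg _), coe_nnnorm,
      Real.norm_eq_abs]
    have h2 := hpos x hx
    refine Real.abs_le_sqrt ?_
    rw [mul_div_mul_left _ _ two_ne_zero, div_pow, hF.sq_sqrt, div_le_iff₀ (by positivity)]
    nlinarith [hCF x ⟨hx.1.le, hx.2.le⟩]

/-- Every global solution of `φ' = √(2F(φ))` that connects `-1` to `1` is a translate of the
profile. -/
theorem IsProfile.exists_eq_translate {F m φ : ℝ → ℝ} (hF : IsStdPotential F)
    (hm : IsProfile F m) (hφ : ∀ x, HasDerivAt φ (√(2 * F (φ x))) x)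
    (htop : Tendsto φ atTop (𝓝 1)) (hbot : Tendsto φ atBot (𝓝 (-1))) :
    ∃ ξ, ∀ x, φ x = m (x - ξ) := by
  have hmono : Monotone φ := monotone_of_hasDerivAt_nonneg hφ fun x => Real.sqrt_nonneg _
  have hcont : Continuous φ := continuous_iff_continuousAt.2 fun x => (hφ x).continuousAt
  have hmem : ∀ x, φ x ∈ Set.Icc (-1 : ℝ) 1 := fun x =>
    ⟨hmono.le_of_tendsto hbot x, hmono.ge_of_tendsto htop x⟩
  obtain ⟨a, ha⟩ := (hbot.eventually (gt_mem_nhds (by norm_num : (-1 : ℝ) < 0))).exists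
  obtain ⟨b, hb⟩ := (htop.eventually (lt_mem_nhds (by norm_num : (0 : ℝ) < 1))).exists
  obtain ⟨ξ, hξ⟩ := mem_range_of_exists_le_of_exists_ge hcont ⟨a, ha.le⟩ ⟨b, hb.le⟩
  obtain ⟨K, hK⟩ := hF.exists_lipschitzOnWith_sqrt
  refine ⟨ξ, fun x => congrFun (ODE_solution_unique_univ (t₀ := ξ) (v := fun _ u => √(2 * F u))
    (s := fun _ => Set.Icc (-1 : ℝ) 1) (g := fun x => m (x - ξ)) (fun _ => hK)
    (fun t => ⟨hφ t, hmem t⟩) (fun t => ⟨?_, hm.mem_Icc _⟩) (by simp [hξ, hm.zero])) x⟩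
  simpa using (hm.ode (t - ξ)).comp_sub_const t ξ

section Directional

variable {E : Type*} [NormedAddCommGroup E] [NormedSpace ℝ E]

theorem Differentiable.hasDerivAt_line {f : E → ℝ} (hf : Differentiable ℝ f) (z e : E) (s : ℝ) :
    HasDerivAt (fun s : ℝ => f (z + s • e)) (fderiv ℝ f (z + s • e) e) s := by
  have h1 : HasDerivAt (fun s : ℝ => z + s • e) e s := by
    simpa using ((hasDerivAt_id s).smul_const e).const_add z
  exact (hf _).hasFDerivAt.comp_hasDerivAt s h1

variable [FiniteDimensional ℝ E] [MeasurableSpace E] [BorelSpace E]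
  (μ : Measure E) [μ.IsAddHaarMeasure]

/-- If a directional derivative of an everywhere differentiable function agrees almost everywhere
with a continuous function, it satisfies the fundamental theorem of calculus on lines. -/
theorem sub_eq_integral_of_ae_fderiv_eq {f w : E → ℝ} (hf : Differentiable ℝ f)
    (hw : Continuous w) {U : Set E} (hU : IsOpen U) (hconv : Convex ℝ U) (e : E)
    (hae : ∀ᵐ z ∂μ, z ∈ U → fderiv ℝ f z e = w z) {z : E} {t : ℝ} (hz : z ∈ U)
    (hzt : z + t • e ∈ U) :
    f (z + t • e) - f z = ∫ s in (0 : ℝ)..t, w (z + s • e) := by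
  have hmeas : MeasurableSet {z | z ∈ U → fderiv ℝ f z e = w z} := by
    have : {z | z ∈ U → fderiv ℝ f z e = w z} = Uᶜ ∪ {z | fderiv ℝ f z e = w z} := by
      ext z; simp [imp_iff_not_or]
    rw [this]
    exact hU.measurableSet.compl.union
      (measurableSet_eq_fun (measurable_fderiv_apply_const ℝ f e) hw.measurable)
  have hline : ∀ᵐ z ∂μ, ∀ᵐ s : ℝ,
      z + s • e ∈ U → fderiv ℝ f (z + s • e) e = w (z + s • e) := by
    rw [Measure.ae_ae_comm]
    · refine Eventually.of_forall fun s => ?_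
      exact (measurePreserving_add_right μ (s • e)).quasiMeasurePreserving.ae hae
    · have : Measurable fun p : E × ℝ => p.1 + p.2 • e :=
        (by fun_prop : Continuous fun p : E × ℝ => p.1 + p.2 • e).measurable
      exact this hmeas
  set V : Set E := {z | z ∈ U ∧ z + t • e ∈ U} with hV
  have hVo : IsOpen V := hU.inter (hU.preimage (by fun_prop : Continuous fun z : E => z + t • e))
  have hclosed : IsClosed {z | f (z + t • e) - f z = ∫ s in (0 : ℝ)..t, w (z + s • e)} := by
    refine isClosed_eq ?_ ?_
    · have := hf.continuous
      fun_prop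
    · exact intervalIntegral.continuous_parametric_intervalIntegral_of_continuous' (by fun_prop) 0 t
  refine hclosed.closure_subset_iff.2 ?_
    ((Measure.dense_of_ae hline).open_subset_closure_inter hVo ⟨hz, hzt⟩)
  rintro z ⟨⟨hz, hzt⟩, hgood⟩
  have hseg : ∀ s ∈ Set.uIcc 0 t, z + s • e ∈ U := by
    have hc : Convex ℝ ((fun s : ℝ => z + s • e) ⁻¹' U) := by
      intro x hx y hy a b ha hb hab
      rw [Set.mem_preimage]
      convert hconv hx hy ha hb hab using 1
      rw [smul_add, smul_add, add_add_add_comm, ← add_smul, hab, one_smul, add_smul,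
        smul_eq_mul, smul_eq_mul, mul_smul, mul_smul]
    intro s hs
    rw [← segment_eq_uIcc] at hs
    exact hc.segment_subset (x := 0) (y := t) (by simpa using hz) hzt hs
  have hEq : ∀ᵐ s : ℝ, s ∈ Set.uIoc 0 t → fderiv ℝ f (z + s • e) e = w (z + s • e) := by
    filter_upwards [hgood] with s hs hmem
    exact hs (hseg s (Set.uIoc_subset_uIcc hmem))
  have hwi : IntervalIntegrable (fun s : ℝ => w (z + s • e)) volume 0 t :=
    Continuous.intervalIntegrable (by fun_prop) _ _
  have hii : IntervalIntegrable (fun s : ℝ => fderiv ℝ f (z + s • e) e) volume 0 t :=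
    hwi.congr_ae ((ae_restrict_iff' measurableSet_uIoc).2 (hEq.mono fun s hs h => (hs h).symm))
  have := intervalIntegral.integral_eq_sub_of_hasDerivAt
    (fun s _ => hf.hasDerivAt_line z e s) hii
  rw [Set.mem_ofPred_eq, ← intervalIntegral.integral_congr_ae hEq, this]
  simp

/-- If a directional derivative of an everywhere differentiable function agrees almost everywhere
with a continuous function, it agrees with it everywhere. -/
theorem fderiv_apply_eq_of_ae {f w : E → ℝ} (hf : Differentiable ℝ f)
    (hw : Continuous w) {U : Set E} (hU : IsOpen U) (hconv : Convex ℝ U) (e : E)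
    (hae : ∀ᵐ z ∂μ, z ∈ U → fderiv ℝ f z e = w z) {z : E} (hz : z ∈ U) :
    fderiv ℝ f z e = w z := by
  have h1 : HasDerivAt (fun s : ℝ => f (z + s • e)) (fderiv ℝ f z e) 0 := by
    simpa using hf.hasDerivAt_line z e 0
  have hc : Continuous fun s : ℝ => w (z + s • e) := by fun_prop
  have h2 : HasDerivAt (fun t : ℝ => f z + ∫ s in (0 : ℝ)..t, w (z + s • e)) (w z) 0 := by
    simpa using (hc.integral_hasStrictDerivAt 0 0).hasDerivAt.const_add (f z)
  refine h1.unique (h2.congr_of_eventuallyEq ?_)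
  have hev : ∀ᶠ t : ℝ in 𝓝 0, z + t • e ∈ U :=
    (hU.preimage (by fun_prop : Continuous fun t : ℝ => z + t • e)).mem_nhds (by simpa using hz)
  filter_upwards [hev] with t ht
  rw [← sub_eq_integral_of_ae_fderiv_eq μ hf hw hU hconv e hae hz ht]
  ring

end Directional

theorem isOpen_domD (d : ℕ) : IsOpen (domD d) := by
  have : domD d = ⋂ i : Fin d, {z : Eucl d | z i.succ ∈ Set.Ioo (0 : ℝ) 1} := by
    ext z; simp [domD]
  rw [this]
  exact isOpen_iInter_of_finite fun i => isOpen_Ioo.preimage (by fun_prop)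

theorem convex_domD (d : ℕ) : Convex ℝ (domD d) := by
  intro x hx y hy a b ha hb hab i
  simpa using (convex_Ioo (0 : ℝ) 1) (hx i) (hy i) ha hb hab

/-- Coordinates `(x, y) ↦ z` on the strip. -/
def stripEquiv (d : ℕ) : ℝ × (Fin d → ℝ) ≃ᵐ Eucl d :=
  (MeasurableEquiv.piFinSuccAbove (fun _ : Fin (d + 1) => ℝ) 0).symm.trans
    (MeasurableEquiv.toLp 2 (Fin (d + 1) → ℝ))

theorem stripEquiv_zero (d : ℕ) (p : ℝ × (Fin d → ℝ)) : stripEquiv d p 0 = p.1 := by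
  simp [stripEquiv, MeasurableEquiv.piFinSuccAbove]

theorem stripEquiv_succ (d : ℕ) (p : ℝ × (Fin d → ℝ)) (i : Fin d) :
    stripEquiv d p i.succ = p.2 i := by
  simp [stripEquiv, MeasurableEquiv.piFinSuccAbove]

theorem measurePreserving_stripEquiv (d : ℕ) : MeasurePreserving (stripEquiv d) :=
  ((volume_preserving_piFinSuccAbove (fun _ : Fin (d + 1) => ℝ) 0).symm _).trans
    (EuclideanSpace.volume_preserving_symm_measurableEquiv_toLp (Fin (d + 1))).symm

theorem stripEquiv_eq_add (d : ℕ) (t : ℝ) (y : Fin d → ℝ) :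
    stripEquiv d (t, y) = stripEquiv d (0, y) + t • EuclideanSpace.single 0 1 := by
  ext j
  refine Fin.cases ?_ (fun i => ?_) j
  · simp [stripEquiv_zero]
  · simp [stripEquiv_succ]

theorem preimage_stripEquiv_domD (d : ℕ) :
    stripEquiv d ⁻¹' domD d = Set.univ ×ˢ Set.univ.pi fun _ => Set.Ioo (0 : ℝ) 1 := by
  ext p
  simp only [domD, Set.mem_preimage, Set.mem_ofPred_eq, stripEquiv_succ]
  simp [Set.mem_pi]

theorem norm_fderiv_sq (d : ℕ) (L : Eucl d →L[ℝ] ℝ) :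
    ‖L‖ ^ 2 = L (EuclideanSpace.single 0 1) ^ 2 +
      ∑ i : Fin d, L (EuclideanSpace.single i.succ 1) ^ 2 := by
  have := (EuclideanSpace.basisFun (Fin (d + 1)) ℝ).norm_dual L
  rw [Fin.sum_univ_succ] at this
  simpa using this

theorem energy_sub_flux {F : ℝ → ℝ} (hF : IsStdPotential F) (d : ℕ) (L : Eucl d →L[ℝ] ℝ)
    (u : ℝ) :
    1/2 * ‖L‖ ^ 2 + F u - √(2 * F u) * L (EuclideanSpace.single 0 1) =
      1/2 * (L (EuclideanSpace.single 0 1) - √(2 * F u)) ^ 2 +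
      1/2 * ∑ i : Fin d, L (EuclideanSpace.single i.succ 1) ^ 2 := by
  rw [norm_fderiv_sq]
  linear_combination (-1/2 : ℝ) * hF.sq_sqrt u

theorem energy_sub_flux_nonneg {F : ℝ → ℝ} (hF : IsStdPotential F) (d : ℕ)
    (L : Eucl d →L[ℝ] ℝ) (u : ℝ) :
    0 ≤ 1/2 * ‖L‖ ^ 2 + F u - √(2 * F u) * L (EuclideanSpace.single 0 1) := by
  rw [energy_sub_flux hF]
  positivity

theorem energy_sub_flux_eq_zero_iff {F : ℝ → ℝ} (hF : IsStdPotential F) (d : ℕ)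
    (L : Eucl d →L[ℝ] ℝ) (u : ℝ) :
    1/2 * ‖L‖ ^ 2 + F u - √(2 * F u) * L (EuclideanSpace.single 0 1) = 0 ↔
      (∀ i : Fin d, L (EuclideanSpace.single i.succ 1) = 0) ∧
        L (EuclideanSpace.single 0 1) = √(2 * F u) := by
  rw [energy_sub_flux hF]
  constructor
  · intro h0
    have hs : 0 ≤ ∑ i : Fin d, L (EuclideanSpace.single i.succ 1) ^ 2 := by positivity
    have hq := sq_nonneg (L (EuclideanSpace.single 0 1) - √(2 * F u))
    have hs0 : ∑ i : Fin d, L (EuclideanSpace.single i.succ 1) ^ 2 = 0 := by linarith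
    have hq0 : (L (EuclideanSpace.single 0 1) - √(2 * F u)) ^ 2 = 0 := by linarith
    refine ⟨fun i => ?_, sub_eq_zero.1 (pow_eq_zero_iff two_ne_zero |>.1 hq0)⟩
    exact pow_eq_zero_iff two_ne_zero |>.1
      ((Finset.sum_eq_zero_iff_of_nonneg fun i _ => sq_nonneg _).1 hs0 i (Finset.mem_univ i))
  · rintro ⟨h1, h2⟩
    simp [h1, h2]

theorem abs_flux_le_energy {F : ℝ → ℝ} (hF : IsStdPotential F) (d : ℕ)
    (L : Eucl d →L[ℝ] ℝ) (u : ℝ) :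
    |√(2 * F u) * L (EuclideanSpace.single 0 1)| ≤ 1/2 * ‖L‖ ^ 2 + F u := by
  have h1 := energy_sub_flux_nonneg hF d L u
  have h2 := energy_sub_flux_nonneg hF d (-L) u
  rw [norm_neg, neg_apply] at h2
  exact abs_le.2 ⟨by linarith, by linarith⟩

theorem integrableOn_flux {d : ℕ} {F : ℝ → ℝ} (hF : IsStdPotential F)
    {h : Eucl d → ℝ} (hdiff : Differentiable ℝ h)
    (hint : IntegrableOn (fun z => 1/2 * ‖fderiv ℝ h z‖ ^ 2 + F (h z)) (domD d)) :
    IntegrableOn (fun z => √(2 * F (h z)) * fderiv ℝ h z (EuclideanSpace.single 0 1))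
      (domD d) := by
  refine Integrable.mono' hint ?_ (Eventually.of_forall fun z => abs_flux_le_energy hF d _ _)
  exact ((hF.continuous_sqrt.comp hdiff.continuous).measurable.mul
    (measurable_fderiv_apply_const ℝ h _)).aestronglyMeasurable

/-- The flux of `√(2F(h))` through the strip depends only on the boundary values. -/
theorem integral_flux {d : ℕ} {F : ℝ → ℝ} (hF : IsStdPotential F)
    {h : Eucl d → ℝ} (hdiff : Differentiable ℝ h) (hbc : BCpm d h)
    (hint : IntegrableOn (fun z => √(2 * F (h z)) * fderiv ℝ h z (EuclideanSpace.single 0 1))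
      (domD d)) :
    ∫ z in domD d, √(2 * F (h z)) * fderiv ℝ h z (EuclideanSpace.single 0 1) = Cstar F := by
  set g : Eucl d → ℝ := fun z => √(2 * F (h z)) * fderiv ℝ h z (EuclideanSpace.single 0 1)
  set Q : Set (Fin d → ℝ) := Set.univ.pi fun _ => Set.Ioo (0 : ℝ) 1 with hQ
  have hmp := measurePreserving_stripEquiv d
  have hemb := (stripEquiv d).measurableEmbedding
  have hint' : Integrable (fun p => g (stripEquiv d p))
      ((volume : Measure ℝ).prod (volume.restrict Q)) := by
    have := (hmp.integrableOn_comp_preimage hemb).2 hint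
    rwa [preimage_stripEquiv_domD, IntegrableOn, Measure.volume_eq_prod,
      ← Measure.prod_restrict, Measure.restrict_univ] at this
  have hQm : MeasurableSet Q := MeasurableSet.univ_pi fun _ => measurableSet_Ioo
  have hprim : ∀ u, HasDerivAt (fun u => ∫ v in (-1 : ℝ)..u, √(2 * F v)) (√(2 * F u)) u :=
    fun u => (hF.continuous_sqrt.integral_hasStrictDerivAt (-1) u).hasDerivAt
  have hline : ∀ᵐ y ∂(volume.restrict Q), ∫ t, g (stripEquiv d (t, y)) = Cstar F := by
    filter_upwards [hint'.prod_left_ae, ae_restrict_mem hQm] with y hy hyQ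
    obtain ⟨c, hc, hcD⟩ : ∃ c : Eucl d,
        (∀ t, stripEquiv d (t, y) = c + t • EuclideanSpace.single 0 1) ∧ c ∈ domD d :=
      ⟨stripEquiv d (0, y), fun t => stripEquiv_eq_add d t y, fun i => by
        rw [stripEquiv_succ]
        exact hyQ i trivial⟩
    obtain ⟨htop, hbot⟩ := hbc c hcD
    have hder := fun t => (hprim _).comp t
      (hdiff.hasDerivAt_line c (EuclideanSpace.single 0 1) t)
    simp_rw [hc] at hy ⊢
    rw [integral_of_hasDerivAt_of_tendsto hder hy
      ((hprim (-1)).continuousAt.tendsto.comp hbot) ((hprim 1).continuousAt.tendsto.comp htop)]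
    simp [Cstar]
  rw [← hmp.setIntegral_preimage_emb hemb, preimage_stripEquiv_domD, Measure.volume_eq_prod,
    ← Measure.prod_restrict, Measure.restrict_univ, integral_prod_symm _ hint',
    integral_congr_ae hline]
  have hvol : volume.real Q = 1 := by
    rw [Measure.real, hQ, Real.volume_pi_Ioo_toReal (by intro i; simp)]
    simp
  simp [hvol]

/-- A function with vanishing `y`-gradient on the strip depends only on `x`. -/
theorem eq_of_fderiv_succ_eq_zero {d : ℕ} {h : Eucl d → ℝ} (hdiff : Differentiable ℝ h)
    (hy : ∀ z ∈ domD d, ∀ i : Fin d, fderiv ℝ h z (EuclideanSpace.single i.succ 1) = 0)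
    {z z' : Eucl d} (hz : z ∈ domD d) (hz' : z' ∈ domD d) (h0 : z 0 = z' 0) : h z = h z' := by
  have hdir : ∀ w ∈ domD d, fderiv ℝ h w (z' - z) = 0 := by
    intro w hw
    have hsum := (EuclideanSpace.basisFun (Fin (d + 1)) ℝ).sum_repr (z' - z)
    rw [← hsum, map_sum, Fin.sum_univ_succ]
    simp [h0, hy w hw]
  have hder : ∀ s ∈ Set.Icc (0 : ℝ) 1, HasDerivAt (fun s : ℝ => h (z + s • (z' - z))) 0 s := by
    intro s hs
    rw [← hdir _ ((convex_domD d).add_smul_sub_mem hz hz' hs)]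
    exact hdiff.hasDerivAt_line z (z' - z) s
  have := constant_of_has_deriv_right_zero
    (fun s hs => (hder s hs).continuousAt.continuousWithinAt)
    (fun s hs => (hder s ⟨hs.1, hs.2.le⟩).hasDerivWithinAt) 1 (by simp)
  simpa using this.symm

/-- The energy lower bound `∫_D ½|∇h|² + F(h) ≥ C*` for configurations with
boundary values `±1`, with equality iff `∇_y h ≡ 0` and `∂_x h = √(2F(h))`; consequently the
minimizers of the free energy are exactly the translates `m_ξ` of the transition profile. -/
theorem statement1 (d : ℕ) (F m : ℝ → ℝ) (hF : IsStdPotential F) (hm : IsProfile F m)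
    (h : Eucl d → ℝ) (hdiff : Differentiable ℝ h) (hbc : BCpm d h)
    (hint : IntegrableOn (fun z => 1/2 * ‖fderiv ℝ h z‖ ^ 2 + F (h z)) (domD d)) :
    (Cstar F ≤ ∫ z in domD d, (1/2 * ‖fderiv ℝ h z‖ ^ 2 + F (h z))) ∧
    ((∫ z in domD d, (1/2 * ‖fderiv ℝ h z‖ ^ 2 + F (h z))) = Cstar F ↔
      ∀ z ∈ domD d,
        (∀ i : Fin d, fderiv ℝ h z (EuclideanSpace.single i.succ 1) = 0) ∧
        fderiv ℝ h z (EuclideanSpace.single 0 1) = Real.sqrt (2 * F (h z))) ∧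
    ((∫ z in domD d, (1/2 * ‖fderiv ℝ h z‖ ^ 2 + F (h z))) = Cstar F ↔
      ∃ ξ : ℝ, ∀ z ∈ domD d, h z = m (z 0 - ξ)) := by
  set e0 : Eucl d := EuclideanSpace.single 0 1 with he0
  have hflux_int := integrableOn_flux hF hdiff hint
  have hflux := integral_flux hF hdiff hbc hflux_int
  have hnn : ∀ z, 0 ≤ 1/2 * ‖fderiv ℝ h z‖ ^ 2 + F (h z) - √(2 * F (h z)) * fderiv ℝ h z e0 :=
    fun z => energy_sub_flux_nonneg hF d _ _
  have hsub : ∫ z in domD d,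
      (1/2 * ‖fderiv ℝ h z‖ ^ 2 + F (h z) - √(2 * F (h z)) * fderiv ℝ h z e0) =
      (∫ z in domD d, (1/2 * ‖fderiv ℝ h z‖ ^ 2 + F (h z))) - Cstar F := by
    rw [← hflux]
    exact integral_sub hint hflux_int
  have hopen := isOpen_domD d
  have hiff : (∫ z in domD d, (1/2 * ‖fderiv ℝ h z‖ ^ 2 + F (h z))) = Cstar F ↔
      ∀ z ∈ domD d,
        (∀ i : Fin d, fderiv ℝ h z (EuclideanSpace.single i.succ 1) = 0) ∧
        fderiv ℝ h z e0 = √(2 * F (h z)) := by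
    rw [← sub_eq_zero, ← hsub]
    constructor
    · intro hzero
      have hae := (integral_eq_zero_iff_of_nonneg hnn (hint.sub hflux_int)).1 hzero
      have hae' : ∀ᵐ z, z ∈ domD d →
          (∀ i : Fin d, fderiv ℝ h z (EuclideanSpace.single i.succ 1) = 0) ∧
          fderiv ℝ h z e0 = √(2 * F (h z)) := by
        filter_upwards [(ae_restrict_iff' hopen.measurableSet).1 hae] with z hz hzD
        exact (energy_sub_flux_eq_zero_iff hF d _ _).1 (hz hzD)
      refine fun z hz => ⟨fun i => ?_, ?_⟩
      · exact fderiv_apply_eq_of_ae volume hdiff (w := fun _ => 0) continuous_const hopen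
          (convex_domD d) _ (hae'.mono fun z hz hzD => (hz hzD).1 i) hz
      · exact fderiv_apply_eq_of_ae volume hdiff (hF.continuous_sqrt.comp hdiff.continuous) hopen
          (convex_domD d) _ (hae'.mono fun z hz hzD => (hz hzD).2) hz
    · intro hall
      exact setIntegral_eq_zero_of_forall_eq_zero fun z hz =>
        (energy_sub_flux_eq_zero_iff hF d _ _).2 (hall z hz)
  refine ⟨?_, hiff, hiff.trans ⟨fun hall => ?_, ?_⟩⟩
  · have := integral_nonneg_of_ae (μ := volume.restrict (domD d)) (Eventually.of_forall hnn)
    rw [hsub] at this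
    linarith
  · set c : Eucl d := stripEquiv d (0, fun _ => 1/2) with hc
    have hmem : ∀ t : ℝ, c + t • e0 ∈ domD d := fun t i => by
      rw [hc, he0, ← stripEquiv_eq_add, stripEquiv_succ]
      norm_num
    have hcD : c ∈ domD d := by simpa using hmem 0
    obtain ⟨ξ, hξ⟩ := hm.exists_eq_translate hF (φ := fun t => h (c + t • e0))
      (fun t => by
        have := hdiff.hasDerivAt_line c e0 t
        rwa [(hall _ (hmem t)).2] at this)
      (hbc c hcD).1 (hbc c hcD).2
    refine ⟨ξ, fun z hz => ?_⟩
    rw [← hξ]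
    refine eq_of_fderiv_succ_eq_zero hdiff (fun z hz => (hall z hz).1) hz (hmem _) ?_
    rw [hc, he0, ← stripEquiv_eq_add, stripEquiv_zero]
  · rintro ⟨ξ, hξ⟩ z hz
    have hev : ∀ e : Eucl d, ∀ᶠ s : ℝ in 𝓝 0, z + s • e ∈ domD d := fun e =>
      (hopen.preimage (by fun_prop : Continuous fun s : ℝ => z + s • e)).mem_nhds
        (by simpa using hz)
    have hder : ∀ e : Eucl d, fderiv ℝ h z e = √(2 * F (h z)) * e 0 := fun e => by
      have h1 : HasDerivAt (fun s : ℝ => h (z + s • e)) (fderiv ℝ h z e) 0 := by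
        simpa using hdiff.hasDerivAt_line z e 0
      have h2 : HasDerivAt (fun s : ℝ => z 0 + s * e 0 - ξ) (e 0) 0 := by
        simpa using (((hasDerivAt_id (0 : ℝ)).mul_const (e 0)).const_add (z 0)).sub_const ξ
      have h3 : HasDerivAt (fun s : ℝ => m (z 0 + s * e 0 - ξ)) (√(2 * F (h z)) * e 0) 0 := by
        have := (hm.ode (z 0 + 0 * e 0 - ξ)).comp (0 : ℝ) h2
        rw [hξ z hz]
        rwa [zero_mul, add_zero] at this
      refine h1.unique (h3.congr_of_eventuallyEq ?_)
      filter_upwards [hev e] with s hs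
      simpa using hξ _ hs
    exact ⟨fun i => by simp [hder], by simp [hder, he0]⟩



end
end

section
/- There exists β > 0 such that for every h ∈ m + L²(D) with dist_{L²(D)}(h, M) < β there is a unique ξ ∈ ℝ with dist_{L²(D)}(h, M) = ‖h − m_ξ‖_{L²(D)}, and this ξ satisfies the orthogonality relation ⟨h − m_ξ, ∂_x m_ξ⟩_{L²(D)} = 0 (existence of tubular/Fermi coordinates near the set of minimizers). -/
open MeasureTheory Real Filter Topology
open scoped ENNReal RealInnerProductSpace

noncomputable section

/-- The `L²(D)` norm of a function on `D`. -/
def rL2 (d : ℕ) (f : Eucl d → ℝ) : ℝ := Real.sqrt (∫ z in domD d, (f z) ^ 2)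

/-- The `L²(D)` distance of `h` to the set `M = {m_ξ : ξ ∈ ℝ}` of minimizers. -/
def rDistM (d : ℕ) (m : ℝ → ℝ) (h : Eucl d → ℝ) : ℝ :=
  ⨅ ξ : ℝ, rL2 d (fun z => h z - m (z 0 - ξ))

section NearestPoint

variable {E : Type*} [NormedAddCommGroup E] [InnerProductSpace ℝ E] {w p : ℝ → E} {P C η c : ℝ}

lemma norm_curve_sub_le (hp : ∀ ξ, ‖p ξ‖ = P) (hC : 0 < C)
    (hw : ∀ ξ δ, |δ| ≤ η → ‖w (ξ + δ) - w ξ + δ • p ξ‖ ≤ C * δ ^ 2) {ξ δ : ℝ} (hδ : |δ| ≤ η) :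
    ‖w (ξ + δ) - w ξ‖ ≤ (C * η + P) * |δ| := by
  have h := norm_sub_le (w (ξ + δ) - w ξ + δ • p ξ) (δ • p ξ)
  rw [add_sub_cancel_right, norm_smul, hp, Real.norm_eq_abs] at h
  have h' := hw ξ δ hδ
  have : C * δ ^ 2 ≤ C * (η * |δ|) := by
    rw [← sq_abs, sq]; gcongr
  linarith

lemma continuous_curve (hp : ∀ ξ, ‖p ξ‖ = P) (hC : 0 < C) (hη : 0 < η)
    (hw : ∀ ξ δ, |δ| ≤ η → ‖w (ξ + δ) - w ξ + δ • p ξ‖ ≤ C * δ ^ 2) : Continuous w := by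
  rw [continuous_iff_continuousAt]
  intro ξ
  rw [ContinuousAt, tendsto_iff_norm_sub_tendsto_zero]
  have hlim : Tendsto (fun y : ℝ => (C * η + P) * |y - ξ|) (𝓝 ξ) (𝓝 0) := by
    have : Continuous (fun y : ℝ => (C * η + P) * |y - ξ|) := by fun_prop
    simpa using this.tendsto ξ
  refine squeeze_zero' (Eventually.of_forall fun _ => norm_nonneg _) ?_ hlim
  filter_upwards [Metric.closedBall_mem_nhds ξ hη] with y hy
  rw [Metric.mem_closedBall, Real.dist_eq] at hy
  simpa using norm_curve_sub_le hp hC hw (ξ := ξ) hy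

/-- First-order optimality at a point of a curve nearest to `v`. -/
lemma inner_eq_zero_of_nearest (hp : ∀ ξ, ‖p ξ‖ = P) (hC : 0 < C) (hη : 0 < η)
    (hw : ∀ ξ δ, |δ| ≤ η → ‖w (ξ + δ) - w ξ + δ • p ξ‖ ≤ C * δ ^ 2) {v : E} {ξ : ℝ}
    (hmin : ∀ ζ, ‖v - w ξ‖ ≤ ‖v - w ζ‖) : ⟪v - w ξ, p ξ⟫ = 0 := by
  set u := v - w ξ with hu
  set a := ⟪u, p ξ⟫ with ha
  set K := C * η + P
  set B := K ^ 2 + 2 * ‖u‖ * C + 1 with hB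
  have hB0 : 0 < B := by positivity
  have key : ∀ δ, |δ| ≤ η → -2 * δ * a ≤ B * δ ^ 2 := by
    intro δ hδ
    set e := w (ξ + δ) - w ξ with he
    have h1 : ‖u‖ ≤ ‖u - e‖ := by
      have := hmin (ξ + δ)
      rwa [show v - w (ξ + δ) = u - e by rw [hu, he]; abel] at this
    have h2 : ‖u‖ ^ 2 ≤ ‖u - e‖ ^ 2 := by gcongr
    rw [norm_sub_sq_real u e] at h2
    have h3 : ‖e‖ ^ 2 ≤ K ^ 2 * δ ^ 2 := by
      have := pow_le_pow_left₀ (norm_nonneg _) (norm_curve_sub_le hp hC hw (ξ := ξ) hδ) 2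
      rwa [mul_pow, sq_abs] at this
    have h4 : |⟪u, e + δ • p ξ⟫| ≤ ‖u‖ * (C * δ ^ 2) :=
      (abs_real_inner_le_norm _ _).trans (by gcongr; exact hw ξ δ hδ)
    rw [inner_add_right, inner_smul_right] at h4
    have h5 := (abs_le.mp h4).1
    have := sq_nonneg δ
    rw [hB]; nlinarith
  by_contra hne
  have hapos : 0 < |a| := abs_pos.mpr hne
  set s := min (η / |a|) (1 / B)
  have hs : 0 < s := lt_min (by positivity) (by positivity)
  have hs1 : s * |a| ≤ η := by
    rw [← le_div_iff₀ hapos]; exact min_le_left _ _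
  have hs2 : s * B ≤ 1 := by
    rw [← le_div_iff₀ hB0]; exact min_le_right _ _
  have h := key (-(s * a)) (by rwa [abs_neg, abs_mul, abs_of_pos hs])
  have hq : 0 < s * a ^ 2 := by positivity
  nlinarith [mul_le_mul_of_nonneg_right hs2 hq.le]

/-- A curve in a Hilbert space with a uniform first-order expansion, which does not come back close
to itself, has unique nearest points in a tubular neighbourhood. -/
theorem exists_tubular_radius (hP : 0 < P) (hp : ∀ ξ, ‖p ξ‖ = P) (hC : 0 < C) (hη : 0 < η)
    (hc : 0 < c) (hCη : C * η ≤ P / 2)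
    (hw : ∀ ξ δ, |δ| ≤ η → ‖w (ξ + δ) - w ξ + δ • p ξ‖ ≤ C * δ ^ 2)
    (hdp : ∀ ξ δ, |δ| ≤ η → ‖p (ξ + δ) - p ξ‖ ≤ C * |δ|)
    (hfar : ∀ ξ δ, η ≤ |δ| → c ≤ ‖w (ξ + δ) - w ξ‖) :
    ∃ β : ℝ, 0 < β ∧ ∀ v : E, ⨅ ξ, ‖v - w ξ‖ < β →
      (∃! ξ, ⨅ ζ, ‖v - w ζ‖ = ‖v - w ξ‖) ∧
      ∀ ξ, ⨅ ζ, ‖v - w ζ‖ = ‖v - w ξ‖ → ⟪v - w ξ, p ξ⟫ = 0 := by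
  refine ⟨min (c / 2) (P ^ 2 / (4 * C)), by positivity, fun v hv => ?_⟩
  set β := min (c / 2) (P ^ 2 / (4 * C))
  have hβ1 : 2 * β ≤ c := by have := min_le_left (c / 2) (P ^ 2 / (4 * C)); linarith
  have hβ2 : β * C ≤ P ^ 2 / 4 := by
    have : β ≤ P ^ 2 / 4 / C := by
      rw [div_div]; exact min_le_right _ _
    rwa [le_div_iff₀ hC] at this
  have hbdd : BddBelow (Set.range fun ζ => ‖v - w ζ‖) := ⟨0, by rintro _ ⟨ζ, rfl⟩; positivity⟩
  have hclose : ∀ ξ ζ, η ≤ |ζ - ξ| → 2 * β ≤ ‖v - w ζ‖ + ‖v - w ξ‖ := by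
    intro ξ ζ h
    have h1 := hfar ξ (ζ - ξ) h
    rw [add_sub_cancel] at h1
    have h2 := norm_sub_le (v - w ξ) (v - w ζ)
    rw [sub_sub_sub_cancel_left] at h2
    linarith
  have hmin : ∀ ξ, ⨅ ζ, ‖v - w ζ‖ = ‖v - w ξ‖ → ∀ ζ, ‖v - w ξ‖ ≤ ‖v - w ζ‖ :=
    fun ξ h ζ => h ▸ ciInf_le hbdd ζ
  have horth : ∀ ξ, ⨅ ζ, ‖v - w ζ‖ = ‖v - w ξ‖ → ⟪v - w ξ, p ξ⟫ = 0 :=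
    fun ξ h => inner_eq_zero_of_nearest hp hC hη hw (hmin ξ h)
  refine ⟨?_, horth⟩
  obtain ⟨ξ₀, hξ₀⟩ := exists_lt_of_ciInf_lt hv
  have hcont : Continuous fun ζ => ‖v - w ζ‖ :=
    (continuous_const.sub (continuous_curve hp hC hη hw)).norm
  obtain ⟨ξ₁, -, hξ₁⟩ := (isCompact_closedBall ξ₀ η).exists_isMinOn
    (Metric.nonempty_closedBall.mpr hη.le) hcont.continuousOn
  have hξ₁₀ : ‖v - w ξ₁‖ ≤ ‖v - w ξ₀‖ := hξ₁ (Metric.mem_closedBall_self hη.le)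
  have hξ₁min : ∀ ζ, ‖v - w ξ₁‖ ≤ ‖v - w ζ‖ := by
    intro ζ
    rcases le_total |ζ - ξ₀| η with h | h
    · exact hξ₁ (by rwa [Metric.mem_closedBall, Real.dist_eq])
    · have := hclose ξ₀ ζ h
      linarith
  refine ⟨ξ₁, le_antisymm (ciInf_le hbdd ξ₁) (le_ciInf hξ₁min), fun ξ hξ => ?_⟩
  have hI₁ : ⨅ ζ, ‖v - w ζ‖ = ‖v - w ξ₁‖ :=
    le_antisymm (ciInf_le hbdd ξ₁) (le_ciInf hξ₁min)
  set δ := ξ₁ - ξ with hδ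
  have hδη : |δ| ≤ η := by
    by_contra! h
    have := hclose ξ ξ₁ h.le
    linarith
  have o₁ := horth ξ₁ hI₁
  have o := horth ξ hξ
  rw [show ξ₁ = ξ + δ by rw [hδ]; ring] at o₁
  have e₁ : |⟪v - w (ξ + δ), p (ξ + δ) - p ξ⟫| ≤ β * (C * |δ|) := by
    refine (abs_real_inner_le_norm _ _).trans ?_
    gcongr
    · rw [show ξ + δ = ξ₁ by rw [hδ]; ring]
      linarith
    · exact hdp ξ δ hδη
  have e₂ : |⟪w (ξ + δ) - w ξ + δ • p ξ, p ξ⟫| ≤ C * δ ^ 2 * P := by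
    refine (abs_real_inner_le_norm _ _).trans ?_
    rw [hp]
    gcongr
    exact hw ξ δ hδη
  have e₃ : ⟪w (ξ + δ) - w ξ + δ • p ξ, p ξ⟫ =
      ⟪v - w (ξ + δ), p (ξ + δ) - p ξ⟫ + δ * P ^ 2 := by
    rw [inner_add_left, real_inner_smul_left, real_inner_self_eq_norm_sq, hp,
      inner_sub_right, o₁, ← sub_sub_sub_cancel_left (w ξ) (w (ξ + δ)) v, inner_sub_left (v - w ξ),
      o]
  rw [e₃] at e₂
  have e₄ : |δ| * P ^ 2 ≤ C * δ ^ 2 * P + β * (C * |δ|) := by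
    calc |δ| * P ^ 2 = |δ * P ^ 2| := by rw [abs_mul, abs_of_pos (pow_pos hP 2)]
      _ = |(⟪v - w (ξ + δ), p (ξ + δ) - p ξ⟫ + δ * P ^ 2)
            - ⟪v - w (ξ + δ), p (ξ + δ) - p ξ⟫| := by rw [add_sub_cancel_left]
      _ ≤ _ := (abs_sub _ _).trans (add_le_add e₂ e₁)
  have e₅ : C * δ ^ 2 * P ≤ P ^ 2 / 2 * |δ| := by
    rw [← sq_abs]
    have : C * |δ| ≤ P / 2 := (by gcongr : C * |δ| ≤ C * η).trans hCη
    nlinarith [mul_le_mul_of_nonneg_right this (mul_nonneg (abs_nonneg δ) hP.le)]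
  have e₆ : β * (C * |δ|) ≤ P ^ 2 / 4 * |δ| := by
    rw [← mul_assoc]; gcongr
  have e₇ : |δ| ≤ 0 := by
    have : 0 < P ^ 2 := by positivity
    by_contra! h
    nlinarith [mul_pos h this]
  have : δ = 0 := abs_nonpos_iff.mp e₇
  linarith

end NearestPoint

/-- The square root of a nonnegative `C²` function is Lipschitz on `[-1, 1]`. -/
lemma exists_lipschitz_sqrt_of_contDiff {G : ℝ → ℝ} (hG : ContDiff ℝ 2 G) (hG0 : ∀ u, 0 ≤ G u) :
    ∃ L : ℝ, 0 < L ∧ ∀ u ∈ Set.Icc (-1 : ℝ) 1, ∀ v ∈ Set.Icc (-1 : ℝ) 1,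
      |√(G u) - √(G v)| ≤ L * |u - v| := by
  have hd : Differentiable ℝ G := hG.differentiable (by norm_num)
  have hG' : ContDiff ℝ 1 (deriv G) := by
    have : ContDiff ℝ (1 + 1) G := by norm_num; exact hG
    exact (contDiff_succ_iff_deriv.mp this).2.2
  have hd' : Differentiable ℝ (deriv G) := hG'.differentiable (by norm_num)
  have hc'' : Continuous (deriv (deriv G)) := hG'.continuous_deriv (by norm_num)
  obtain ⟨A, hA⟩ := (isCompact_Icc (a := (-3 : ℝ)) (b := 3)).exists_bound_of_continuousOn
    hc''.continuousOn
  obtain ⟨A', hA'⟩ := (isCompact_Icc (a := (-3 : ℝ)) (b := 3)).exists_bound_of_continuousOn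
    hG'.continuous.continuousOn
  set K := max (max A A') 1
  have hK : 0 < K := lt_of_lt_of_le one_pos (le_max_right _ _)
  have hKA : ∀ x ∈ Set.Icc (-3 : ℝ) 3, ‖deriv (deriv G) x‖ ≤ K := fun x hx =>
    (hA x hx).trans ((le_max_left _ _).trans (le_max_left _ _))
  have hKA' : ∀ x ∈ Set.Icc (-3 : ℝ) 3, ‖deriv G x‖ ≤ K := fun x hx =>
    (hA' x hx).trans ((le_max_right _ _).trans (le_max_left _ _))
  have taylor : ∀ u ∈ Set.Icc (-3 : ℝ) 3, ∀ v ∈ Set.Icc (-3 : ℝ) 3,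
      G v ≤ G u + deriv G u * (v - u) + K * (v - u) ^ 2 := by
    intro u hu v hv
    have hsub : Set.uIcc u v ⊆ Set.Icc (-3 : ℝ) 3 := Set.uIcc_subset_Icc hu hv
    have h1 : ∀ x ∈ Set.uIcc u v, ‖deriv G x - deriv G u‖ ≤ K * |v - u| := by
      intro x hx
      refine ((convex_Icc (-3 : ℝ) 3).norm_image_sub_le_of_norm_deriv_le
        (fun y _ => hd' y) hKA hu (hsub hx)).trans ?_
      rw [Real.norm_eq_abs]
      gcongr ?_ * ?_
      exact Set.abs_sub_left_of_mem_uIcc hx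
    have h2 := (convex_uIcc u v).norm_image_sub_le_of_norm_hasDerivWithin_le
      (f := fun x => G x - deriv G u * x) (f' := fun x => deriv G x - deriv G u)
      (fun x _ => by
        simpa using
          ((hd x).hasDerivAt.fun_sub ((hasDerivAt_id x).const_mul (deriv G u))).hasDerivWithinAt)
      h1 Set.left_mem_uIcc Set.right_mem_uIcc
    rw [Real.norm_eq_abs, Real.norm_eq_abs, mul_assoc, ← sq, sq_abs] at h2
    have := (abs_le.mp h2).2
    linarith
  have glaeser : ∀ u ∈ Set.Icc (-1 : ℝ) 1, deriv G u ^ 2 ≤ 4 * K * G u := by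
    intro u hu
    have hb := hKA' u ⟨by linarith [hu.1], by linarith [hu.2]⟩
    rw [Real.norm_eq_abs, abs_le] at hb
    set t := deriv G u / (2 * K) with ht
    have htK : deriv G u = 2 * K * t := by rw [ht]; field_simp
    have h1 : t ≤ 1 := by rw [ht, div_le_one (by positivity)]; linarith
    have h2 : -1 ≤ t := by rw [ht, le_div_iff₀ (by positivity)]; linarith
    have := taylor u ⟨by linarith [hu.1], by linarith [hu.2]⟩ (u - t)
      ⟨by linarith [hu.1], by linarith [hu.2]⟩
    have h3 := hG0 (u - t)
    rw [htK] at this ⊢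
    nlinarith
  have one_side : ∀ u ∈ Set.Icc (-1 : ℝ) 1, ∀ v ∈ Set.Icc (-1 : ℝ) 1,
      √(G v) ≤ √(G u) + √K * |v - u| := by
    intro u hu v hv
    apply Real.sqrt_le_iff.mpr ⟨by positivity, ?_⟩
    have h1 := taylor u ⟨by linarith [hu.1], by linarith [hu.2]⟩ v
      ⟨by linarith [hv.1], by linarith [hv.2]⟩
    have h2 : |deriv G u| ≤ 2 * √K * √(G u) := by
      apply abs_le_of_sq_le_sq _ (by positivity)
      rw [mul_pow, mul_pow, Real.sq_sqrt hK.le, Real.sq_sqrt (hG0 u)]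
      linarith [glaeser u hu]
    have h3 : deriv G u * (v - u) ≤ 2 * √K * √(G u) * |v - u| := by
      refine (le_abs_self _).trans ?_
      rw [abs_mul]; gcongr
    have h4 : (√(G u) + √K * |v - u|) ^ 2
        = G u + 2 * √K * √(G u) * |v - u| + K * (v - u) ^ 2 := by
      rw [add_sq, mul_pow, Real.sq_sqrt hK.le, Real.sq_sqrt (hG0 u), sq_abs]; ring
    linarith
  refine ⟨√K, by positivity, fun u hu v hv => abs_le.mpr ⟨?_, ?_⟩⟩
  · have := one_side u hu v hv
    rw [abs_sub_comm] at this
    linarith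
  · have := one_side v hv u hu
    linarith

section Profile

variable {m p : ℝ → ℝ} {L : ℝ}

lemma continuous_speed (hm : ∀ x, HasDerivAt m (p x) x)
    (hLip : ∀ x y, |p x - p y| ≤ L * |m x - m y|) : Continuous p := by
  have hmc : Continuous m := continuous_iff_continuousAt.mpr fun x => (hm x).continuousAt
  rw [continuous_iff_continuousAt]
  intro x
  rw [ContinuousAt, tendsto_iff_norm_sub_tendsto_zero]
  have hlim : Tendsto (fun y => L * |m y - m x|) (𝓝 x) (𝓝 0) := by
    have : Continuous fun y => L * |m y - m x| := by fun_prop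
    simpa using this.tendsto x
  exact squeeze_zero (fun _ => norm_nonneg _) (fun y => hLip y x) hlim

lemma speed_le_two_mul (hm : ∀ x, HasDerivAt m (p x) x) (hp0 : ∀ x, 0 ≤ p x) (hL : 0 < L)
    (hLip : ∀ x y, |p x - p y| ≤ L * |m x - m y|) {x δ : ℝ} (hδ : L * |δ| ≤ 1 / 4) :
    ∀ y ∈ Set.uIcc x (x + δ), p y ≤ 2 * p x := by
  have hpc : Continuous p := continuous_speed hm hLip
  obtain ⟨z, hz, hzmax⟩ := (isCompact_uIcc (a := x) (b := x + δ)).exists_isMaxOn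
    Set.nonempty_uIcc hpc.continuousOn
  have h1 : |m z - m x| ≤ p z * |δ| := by
    refine ((convex_uIcc x (x + δ)).norm_image_sub_le_of_norm_hasDerivWithin_le
      (f := m) (f' := p) (fun y _ => (hm y).hasDerivWithinAt)
      (fun y hy => by rw [Real.norm_of_nonneg (hp0 y)]; exact hzmax hy)
      Set.left_mem_uIcc hz).trans ?_
    rw [Real.norm_eq_abs]
    gcongr ?_ * ?_
    · exact hp0 z
    · simpa using Set.abs_sub_left_of_mem_uIcc hz
  have h2 := (abs_le.mp (hLip z x)).2
  have h3 : L * |m z - m x| ≤ p z * (1 / 4) := by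
    calc L * |m z - m x| ≤ L * (p z * |δ|) := by gcongr
      _ = p z * (L * |δ|) := by ring
      _ ≤ _ := by gcongr; exact hp0 z
  intro y hy
  have h4 : p y ≤ p z := hzmax hy
  have := hp0 z
  linarith

lemma abs_speed_sub_le (hm : ∀ x, HasDerivAt m (p x) x) (hp0 : ∀ x, 0 ≤ p x) (hL : 0 < L)
    (hLip : ∀ x y, |p x - p y| ≤ L * |m x - m y|) {x δ : ℝ} (hδ : L * |δ| ≤ 1 / 4) :
    ∀ y ∈ Set.uIcc x (x + δ), |p y - p x| ≤ 2 * L * |δ| * p x := by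
  intro y hy
  have h1 : |m y - m x| ≤ 2 * p x * |δ| := by
    refine ((convex_uIcc x (x + δ)).norm_image_sub_le_of_norm_hasDerivWithin_le
      (f := m) (f' := p) (fun y _ => (hm y).hasDerivWithinAt)
      (fun y hy => by
        rw [Real.norm_of_nonneg (hp0 y)]; exact speed_le_two_mul hm hp0 hL hLip hδ y hy)
      Set.left_mem_uIcc hy).trans ?_
    rw [Real.norm_eq_abs]
    gcongr ?_ * ?_
    · exact mul_nonneg two_pos.le (hp0 x)
    · simpa using Set.abs_sub_left_of_mem_uIcc hy
  calc |p y - p x| ≤ L * |m y - m x| := hLip y x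
    _ ≤ L * (2 * p x * |δ|) := by gcongr
    _ = _ := by ring

lemma abs_profile_sub_sub_le (hm : ∀ x, HasDerivAt m (p x) x) (hp0 : ∀ x, 0 ≤ p x) (hL : 0 < L)
    (hLip : ∀ x y, |p x - p y| ≤ L * |m x - m y|) {x δ : ℝ} (hδ : L * |δ| ≤ 1 / 4) :
    |m (x + δ) - m x - δ * p x| ≤ 2 * L * δ ^ 2 * p x := by
  have h := (convex_uIcc x (x + δ)).norm_image_sub_le_of_norm_hasDerivWithin_le
    (f := fun y => m y - p x * y) (f' := fun y => p y - p x)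
    (fun y _ => by
      simpa using ((hm y).fun_sub ((hasDerivAt_id y).const_mul (p x))).hasDerivWithinAt)
    (fun y hy => abs_speed_sub_le hm hp0 hL hLip hδ y hy) Set.left_mem_uIcc Set.right_mem_uIcc
  rw [Real.norm_eq_abs, Real.norm_eq_abs, add_sub_cancel_left] at h
  calc |m (x + δ) - m x - δ * p x| = |m (x + δ) - p x * (x + δ) - (m x - p x * x)| := by
        congr 1; ring
    _ ≤ 2 * L * |δ| * p x * |δ| := h
    _ = 2 * L * |δ| ^ 2 * p x := by ring
    _ = _ := by rw [sq_abs]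

/-- Translating a profile by at least `η` moves it, at every point, by a definite fraction of its
speed. -/
lemma mul_speed_le_abs_profile_sub (hm : ∀ x, HasDerivAt m (p x) x) (hp0 : ∀ x, 0 ≤ p x)
    (hL : 0 < L) (hLip : ∀ x y, |p x - p y| ≤ L * |m x - m y|) {η : ℝ} (hη : 0 < η)
    (hLη : L * η ≤ 1 / 4) {x δ : ℝ} (hδ : η ≤ |δ|) :
    η / 2 * p x ≤ |m (x + δ) - m x| := by
  have hmono : Monotone m := monotone_of_deriv_nonneg (fun x => (hm x).differentiableAt)
    fun x => by rw [(hm x).deriv]; exact hp0 x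
  have hsmall : 2 * L * η ^ 2 * p x ≤ η / 2 * p x := by
    have := hp0 x
    gcongr
    nlinarith
  rcases le_abs.mp hδ with h | h
  · have h1 := (abs_le.mp (abs_profile_sub_sub_le hm hp0 hL hLip (x := x) (δ := η)
      (by rwa [abs_of_pos hη]))).1
    have h2 : m (x + η) ≤ m (x + δ) := hmono (by linarith)
    refine le_trans ?_ (le_abs_self _)
    linarith
  · have h1 := (abs_le.mp (abs_profile_sub_sub_le hm hp0 hL hLip (x := x) (δ := -η)
      (by rwa [abs_neg, abs_of_pos hη]))).2
    have h2 : m (x + δ) ≤ m (x + -η) := hmono (by linarith)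
    refine le_trans ?_ (neg_le_abs _)
    rw [neg_sq] at h1
    linarith

lemma memLp_two_speed {a b : ℝ} (hm : ∀ x, HasDerivAt m (p x) x) (hp0 : ∀ x, 0 ≤ p x)
    (hpc : Continuous p) (htop : Tendsto m atTop (𝓝 b)) (hbot : Tendsto m atBot (𝓝 a))
    {B : ℝ} (hB : ∀ x, p x ≤ B) : MemLp p 2 := by
  have hint : Integrable p := by
    rw [← integrableOn_univ, ← Set.Iic_union_Ioi (a := (0 : ℝ)), integrableOn_union]
    refine ⟨?_, integrableOn_Ioi_deriv_of_nonneg' (fun x _ => hm x) (fun x _ => hp0 x) htop⟩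
    refine integrableOn_Iic_of_intervalIntegral_norm_tendsto (m 0 - a) 0
      (fun x => hpc.integrableOn_Ioc) tendsto_id ?_
    have : ∀ i : ℝ, ∫ x in i..0, ‖p x‖ = m 0 - m i := fun i => by
      simp_rw [Real.norm_of_nonneg (hp0 _)]
      exact intervalIntegral.integral_eq_sub_of_hasDerivAt (fun x _ => hm x)
        (hpc.intervalIntegrable _ _)
    simp only [id, this]
    exact tendsto_const_nhds.sub hbot
  rw [memLp_two_iff_integrable_sq hpc.aestronglyMeasurable]
  refine (hint.const_mul B).mono' (by fun_prop) (ae_of_all _ fun x => ?_)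
  rw [Real.norm_of_nonneg (sq_nonneg _), sq]
  exact mul_le_mul_of_nonneg_right (hB x) (hp0 x)

lemma memLp_two_translate_sub (hm : ∀ x, HasDerivAt m (p x) x) (hp0 : ∀ x, 0 ≤ p x) (hL : 0 < L)
    (hLip : ∀ x y, |p x - p y| ≤ L * |m x - m y|) (hp2 : MemLp p 2) (ξ : ℝ) :
    MemLp (fun x => m (x + ξ) - m x) 2 := by
  have hmc : Continuous m := continuous_iff_continuousAt.mpr fun x => (hm x).continuousAt
  have small : ∀ δ, L * |δ| ≤ 1 / 4 → MemLp (fun x => m (x + δ) - m x) 2 := by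
    intro δ hδ
    refine hp2.of_le_mul (c := 2 * |δ|) (by fun_prop) (ae_of_all _ fun x => ?_)
    rw [Real.norm_eq_abs, Real.norm_of_nonneg (hp0 x)]
    have h1 := abs_profile_sub_sub_le hm hp0 hL hLip (x := x) hδ
    have h2 : |m (x + δ) - m x| ≤ |m (x + δ) - m x - δ * p x| + |δ * p x| := by
      simpa using abs_add_le (m (x + δ) - m x - δ * p x) (δ * p x)
    rw [abs_mul, abs_of_nonneg (hp0 x)] at h2
    have h3 : 2 * L * δ ^ 2 * p x ≤ |δ| * p x := by
      have := hp0 x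
      have := abs_nonneg δ
      gcongr
      rw [← sq_abs]
      nlinarith
    linarith
  obtain ⟨n, hn⟩ := exists_nat_gt (4 * L * |ξ|)
  have hn0 : (0 : ℝ) < n := lt_of_le_of_lt (by positivity) hn
  have hstep : L * |ξ / n| ≤ 1 / 4 := by
    rw [abs_div, abs_of_pos hn0, ← mul_div_assoc, div_le_iff₀ hn0]
    linarith
  have key : ∀ k : ℕ, MemLp (fun x => m (x + k * (ξ / n)) - m x) 2 := by
    intro k
    induction k with
    | zero => simp
    | succ k ih =>
      have h := ((small _ hstep).comp_measurePreserving
        (measurePreserving_add_right volume (k * (ξ / n)))).add ih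
      refine h.ae_eq (ae_of_all _ fun x => ?_)
      simp only [Pi.add_apply, Function.comp_apply, Nat.cast_succ, add_mul, one_mul, add_assoc]
      ring
  have h := key n
  rwa [mul_div_cancel₀ _ hn0.ne'] at h

end Profile

section L2

variable {Ω : Type*} [MeasurableSpace Ω] {μ : Measure Ω}

lemma real_inner_toLp {f g : Ω → ℝ} (hf : MemLp f 2 μ) (hg : MemLp g 2 μ) :
    ⟪hf.toLp f, hg.toLp g⟫ = ∫ z, f z * g z ∂μ := by
  rw [L2.inner_def]
  refine integral_congr_ae ?_
  filter_upwards [hf.coeFn_toLp, hg.coeFn_toLp] with z h1 h2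
  rw [h1, h2, real_inner_eq_re_inner, RCLike.inner_apply']
  simp

lemma norm_toLp_two {f : Ω → ℝ} (hf : MemLp f 2 μ) : ‖hf.toLp f‖ = √(∫ z, f z ^ 2 ∂μ) := by
  rw [norm_eq_sqrt_real_inner, real_inner_toLp]
  simp only [sq]

/-- Fermi coordinates near the translates `m (X - ξ)` of a profile, where `X` pushes `μ` forward to
Lebesgue measure. -/
theorem exists_tubular_radius_profile {m p : ℝ → ℝ} {L : ℝ} {X : Ω → ℝ}
    (hX : MeasurePreserving X μ volume) (hm : ∀ x, HasDerivAt m (p x) x) (hp0 : ∀ x, 0 ≤ p x)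
    (hL : 0 < L) (hLip : ∀ x y, |p x - p y| ≤ L * |m x - m y|) (hp2 : MemLp p 2)
    (hpos : p 0 ≠ 0) :
    ∃ β : ℝ, 0 < β ∧ ∀ h : Ω → ℝ, AEStronglyMeasurable h μ →
      Integrable (fun z => (h z - m (X z)) ^ 2) μ →
      ⨅ ξ, √(∫ z, (h z - m (X z - ξ)) ^ 2 ∂μ) < β →
      (∃! ξ, ⨅ ζ, √(∫ z, (h z - m (X z - ζ)) ^ 2 ∂μ) = √(∫ z, (h z - m (X z - ξ)) ^ 2 ∂μ)) ∧
      ∀ ξ, ⨅ ζ, √(∫ z, (h z - m (X z - ζ)) ^ 2 ∂μ) = √(∫ z, (h z - m (X z - ξ)) ^ 2 ∂μ) →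
        ∫ z, (h z - m (X z - ξ)) * p (X z - ξ) ∂μ = 0 := by
  have hmc : Continuous m := continuous_iff_continuousAt.mpr fun x => (hm x).continuousAt
  have hpc : Continuous p := continuous_speed hm hLip
  have hw : ∀ ξ, MemLp (fun z => m (X z - ξ) - m (X z)) 2 μ := fun ξ => by
    simpa only [sub_eq_add_neg, Function.comp_def] using
      (memLp_two_translate_sub hm hp0 hL hLip hp2 (-ξ)).comp_measurePreserving hX
  have hXξ : ∀ ξ, MeasurePreserving (fun z => X z - ξ) μ volume := fun ξ =>
    (measurePreserving_sub_right volume ξ).comp hX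
  have hp : ∀ ξ, MemLp (fun z => p (X z - ξ)) 2 μ := fun ξ => hp2.comp_measurePreserving (hXξ ξ)
  set P := (eLpNorm p 2 volume).toReal with hPdef
  have hP : 0 < P := by
    refine ENNReal.toReal_pos (fun h0 => hpos ?_) hp2.eLpNorm_ne_top
    rw [eLpNorm_eq_zero_iff hpc.aestronglyMeasurable two_ne_zero] at h0
    exact congrFun ((Continuous.ae_eq_iff_eq volume hpc continuous_zero).mp h0) 0
  have hpP : ∀ ξ, ‖(hp ξ).toLp‖ = P := fun ξ => by
    rw [Lp.norm_toLp, hPdef]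
    congr 1
    exact eLpNorm_comp_measurePreserving hpc.aestronglyMeasurable (hXξ ξ)
  set η := 1 / (4 * L) with hηdef
  have hη : 0 < η := by positivity
  have hLη : L * η = 1 / 4 := by rw [hηdef]; field_simp
  have hsmall : ∀ δ, |δ| ≤ η → L * |-δ| ≤ 1 / 4 := fun δ hδ => by
    rw [abs_neg, ← hLη]; gcongr
  have shift : ∀ ξ δ z, X z - (ξ + δ) = X z - ξ + -δ := fun _ _ _ => by ring
  have hwexp : ∀ ξ δ, |δ| ≤ η →
      ‖(hw (ξ + δ)).toLp - (hw ξ).toLp + δ • (hp ξ).toLp‖ ≤ 2 * L * P * δ ^ 2 := by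
    intro ξ δ hδ
    rw [← MemLp.toLp_const_smul, ← MemLp.toLp_sub, ← MemLp.toLp_add]
    refine (Lp.norm_le_mul_norm_of_ae_le_mul (c := 2 * L * δ ^ 2) (g := (hp ξ).toLp) ?_).trans
      (le_of_eq (by rw [hpP]; ring))
    filter_upwards [MemLp.coeFn_toLp (((hw (ξ + δ)).sub (hw ξ)).add ((hp ξ).const_smul δ)),
      (hp ξ).coeFn_toLp] with z h1 h2
    rw [h1, h2, Real.norm_of_nonneg (hp0 _), Real.norm_eq_abs]
    have := abs_profile_sub_sub_le hm hp0 hL hLip (x := X z - ξ) (hsmall δ hδ)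
    rw [neg_sq] at this
    refine le_trans (le_of_eq ?_) this
    simp only [Pi.add_apply, Pi.sub_apply, Pi.smul_apply, smul_eq_mul, shift]
    congr 1
    ring
  have hpexp : ∀ ξ δ, |δ| ≤ η → ‖(hp (ξ + δ)).toLp - (hp ξ).toLp‖ ≤ 2 * L * P * |δ| := by
    intro ξ δ hδ
    rw [← MemLp.toLp_sub]
    refine (Lp.norm_le_mul_norm_of_ae_le_mul (c := 2 * L * |δ|) (g := (hp ξ).toLp) ?_).trans
      (le_of_eq (by rw [hpP]; ring))
    filter_upwards [MemLp.coeFn_toLp ((hp (ξ + δ)).sub (hp ξ)), (hp ξ).coeFn_toLp] with z h1 h2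
    rw [h1, h2, Real.norm_of_nonneg (hp0 _), Real.norm_eq_abs]
    have := abs_speed_sub_le hm hp0 hL hLip (x := X z - ξ) (hsmall δ hδ) _ Set.right_mem_uIcc
    rw [abs_neg] at this
    simpa only [Pi.sub_apply, shift] using this
  have hfar : ∀ ξ δ, η ≤ |δ| → η / 2 * P ≤ ‖(hw (ξ + δ)).toLp - (hw ξ).toLp‖ := by
    intro ξ δ hδ
    rw [← MemLp.toLp_sub, ← le_div_iff₀' (by positivity), ← hpP ξ]
    refine (Lp.norm_le_mul_norm_of_ae_le_mul (c := (η / 2)⁻¹)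
      (g := ((hw (ξ + δ)).sub (hw ξ)).toLp) ?_).trans (div_eq_inv_mul _ _).ge
    filter_upwards [MemLp.coeFn_toLp ((hw (ξ + δ)).sub (hw ξ)), (hp ξ).coeFn_toLp] with z h1 h2
    rw [h1, h2, Real.norm_of_nonneg (hp0 _), Real.norm_eq_abs, le_inv_mul_iff₀ (by positivity)]
    have := mul_speed_le_abs_profile_sub hm hp0 hL hLip hη hLη.le (x := X z - ξ) (δ := -δ)
      (by rwa [abs_neg])
    simpa only [Pi.sub_apply, shift, sub_sub_sub_cancel_right] using this
  obtain ⟨β, hβ, H⟩ := exists_tubular_radius (w := fun ξ => (hw ξ).toLp)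
    (p := fun ξ => (hp ξ).toLp) (C := 2 * L * P) (η := η) (c := η / 2 * P) hP hpP
    (by positivity) hη (by positivity) (le_of_eq (by linear_combination 2 * P * hLη))
    hwexp hpexp hfar
  refine ⟨β, hβ, fun h hh hint => ?_⟩
  have hmX : AEStronglyMeasurable (fun z => m (X z)) μ :=
    hmc.comp_aestronglyMeasurable hX.aemeasurable.aestronglyMeasurable
  have hv : MemLp (fun z => h z - m (X z)) 2 μ :=
    (memLp_two_iff_integrable_sq (hh.sub hmX)).mpr hint
  have hvw : ∀ ξ, MemLp (fun z => h z - m (X z - ξ)) 2 μ := fun ξ => by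
    convert hv.sub (hw ξ) using 1
    ext z; simp
  have hsub : ∀ ξ, hv.toLp - (hw ξ).toLp = (hvw ξ).toLp := fun ξ => by
    rw [← MemLp.toLp_sub]
    exact MemLp.toLp_congr _ _ (ae_of_all _ fun z => by simp)
  have := H hv.toLp
  simpa only [hsub, norm_toLp_two, real_inner_toLp] using this

end L2

/-- The first coordinate pushes Lebesgue measure on the cylinder `D` forward to Lebesgue measure on
the line. -/
lemma measurePreserving_coord_zero (d : ℕ) :
    MeasurePreserving (fun z : Eucl d => z 0) (volume.restrict (domD d)) volume := by
  have hmeas : Measurable fun z : Eucl d => z 0 := by fun_prop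
  refine ⟨hmeas, Measure.ext fun s hs => ?_⟩
  rw [Measure.map_apply hmeas hs, Measure.restrict_apply (hmeas hs)]
  set t : Fin (d + 1) → Set ℝ := Fin.cons s fun _ => Set.Ioo 0 1 with ht
  have hset : (fun z : Eucl d => z 0) ⁻¹' s ∩ domD d =
      @WithLp.ofLp 2 (Fin (d + 1) → ℝ) ⁻¹' Set.pi Set.univ t := by
    ext z
    simp [domD, ht, Fin.forall_fin_succ]
  have htm : MeasurableSet (Set.pi Set.univ t) :=
    MeasurableSet.univ_pi (Fin.forall_fin_succ.mpr ⟨by simpa [ht] using hs, by simp [ht]⟩)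
  rw [hset, (PiLp.volume_preserving_ofLp (Fin (d + 1))).measure_preimage htm.nullMeasurableSet,
    volume_pi_pi, Fin.prod_univ_succ]
  simp [ht]

/-- Existence of tubular (Fermi) coordinates: for configurations
`h ∈ m + L²(D)` close enough to `M` there is a unique `ξ` realizing the distance to `M`,
and it satisfies the orthogonality relation `⟨h - m_ξ, ∂_x m_ξ⟩_{L²(D)} = 0`. -/
theorem statement5 (d : ℕ) (F m : ℝ → ℝ) (hF : IsStdPotential F) (hm : IsProfile F m) :
    ∃ β : ℝ, 0 < β ∧ ∀ h : Eucl d → ℝ,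
      AEStronglyMeasurable h (volume.restrict (domD d)) →
      IntegrableOn (fun z : Eucl d => (h z - m (z 0)) ^ 2) (domD d) →
      rDistM d m h < β →
      ((∃! ξ : ℝ, rDistM d m h = rL2 d (fun z => h z - m (z 0 - ξ))) ∧
       (∀ ξ : ℝ, rDistM d m h = rL2 d (fun z => h z - m (z 0 - ξ)) →
          (∫ z in domD d, (h z - m (z 0 - ξ)) * deriv m (z 0 - ξ)) = 0)) := by
  have hG : ContDiff ℝ 2 fun u => 2 * F u := contDiff_const.mul (hF.smooth.of_le (by norm_num))
  have hG0 : ∀ u, 0 ≤ 2 * F u := fun u => mul_nonneg two_pos.le (hF.nonneg u)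
  obtain ⟨L, hL, hs⟩ := exists_lipschitz_sqrt_of_contDiff hG hG0
  have hLip : ∀ x y, |√(2 * F (m x)) - √(2 * F (m y))| ≤ L * |m x - m y| := fun x y =>
    hs _ (hm.mem_Icc x) _ (hm.mem_Icc y)
  have hbound : ∀ x, √(2 * F (m x)) ≤ L * 2 := fun x => by
    have h := hs _ (hm.mem_Icc x) 1 (by norm_num)
    rw [(hF.zero_iff 1).mpr (Or.inl rfl), mul_zero, Real.sqrt_zero, sub_zero] at h
    refine (le_abs_self _).trans (h.trans ?_)
    have := hm.mem_Icc x
    gcongr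
    exact abs_le.mpr ⟨by linarith [this.1], by linarith [this.2]⟩
  have hp0 : ∀ x, 0 ≤ √(2 * F (m x)) := fun x => Real.sqrt_nonneg _
  have hp2 := memLp_two_speed hm.ode hp0 (continuous_speed hm.ode hLip) hm.limit_top hm.limit_bot
    hbound
  have hpos : √(2 * F (m 0)) ≠ 0 := by
    rw [hm.zero, Real.sqrt_ne_zero (hG0 0)]
    have : F 0 ≠ 0 := fun h => by
      have := (hF.zero_iff 0).mp h
      norm_num at this
    simpa using this
  have hderiv : deriv m = fun x => √(2 * F (m x)) := funext fun x => (hm.ode x).deriv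
  rw [hderiv]
  exact exists_tubular_radius_profile (measurePreserving_coord_zero d) hm.ode hp0 hL hLip hp2 hpos


end
end

section
/- There exist constants c₀, δ₀ > 0 such that for all δ ≤ δ₀ and every piecewise differentiable h : D → ℝ with boundary conditions h(±∞, y) = ±1 and dist_{L²(D)}(h, M) > δ, one has 𝓕(h) > c₀ δ². -/
open MeasureTheory Real Filter Topology
open scoped ENNReal RealInnerProductSpace

noncomputable section

/-- The `L²(D)` norm, as an extended real number. -/
def eL2 (d : ℕ) (f : Eucl d → ℝ) : ℝ≥0∞ :=
  (∫⁻ z in domD d, ENNReal.ofReal ((f z) ^ 2)) ^ (1/2 : ℝ)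

/-- The `L²(D)` distance of `h` to the set of minimizers `M`, as an extended real number. -/
def eDistM (d : ℕ) (m : ℝ → ℝ) (h : Eucl d → ℝ) : ℝ≥0∞ :=
  ⨅ ξ : ℝ, eL2 d (fun z => h z - m (z 0 - ξ))

/-- The (not yet renormalized) Allen--Cahn energy `∫_D ½|∇h|² + F(h)`, as an extended
real number (the free energy is `𝓕(h) = eEnergyD d F h - C*`). -/
def eEnergyD (d : ℕ) (F : ℝ → ℝ) (h : Eucl d → ℝ) : ℝ≥0∞ :=
  ∫⁻ z in domD d, ENNReal.ofReal (1/2 * ‖fderiv ℝ h z‖ ^ 2 + F (h z))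

theorem LocallyLipschitz.absolutelyContinuousOnInterval {f : ℝ → ℝ} (hf : LocallyLipschitz f)
    (a b : ℝ) : AbsolutelyContinuousOnInterval f a b := by
  obtain ⟨K, hK⟩ := (hf.locallyLipschitzOn (s := Set.uIcc a b)).exists_lipschitzOnWith_of_compact
    isCompact_uIcc
  exact hK.absolutelyContinuousOnInterval

/-- Rademacher's theorem for locally Lipschitz functions. -/
theorem LocallyLipschitz.ae_differentiableAt {E : Type*} [NormedAddCommGroup E] [NormedSpace ℝ E]
    [FiniteDimensional ℝ E] [MeasurableSpace E] [BorelSpace E] {μ : Measure E}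
    [μ.IsAddHaarMeasure] {f : E → ℝ} (hf : LocallyLipschitz f) :
    ∀ᵐ x ∂μ, DifferentiableAt ℝ f x := by
  have key : ∀ n : ℕ, ∀ᵐ x ∂μ, x ∈ Metric.closedBall (0 : E) n →
      DifferentiableWithinAt ℝ f (Metric.closedBall (0 : E) n) x := fun n => by
    have : ProperSpace E := FiniteDimensional.proper ℝ E
    obtain ⟨K, hK⟩ := (hf.locallyLipschitzOn
      (s := Metric.closedBall (0 : E) n)).exists_lipschitzOnWith_of_compact
      (isCompact_closedBall _ _)
    exact hK.ae_differentiableWithinAt_of_mem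
  filter_upwards [ae_all_iff.2 key] with x hx
  obtain ⟨n, hn⟩ := exists_nat_gt ‖x‖
  have hmem : x ∈ Metric.ball (0 : E) n := by simpa using hn
  exact (hx n (Metric.ball_subset_closedBall hmem)).differentiableAt
    (Filter.mem_of_superset (Metric.isOpen_ball.mem_nhds hmem) Metric.ball_subset_closedBall)

theorem LocallyLipschitz.sub_le_integral {f φ : ℝ → ℝ} (hf : LocallyLipschitz f) {a b : ℝ}
    (hab : a ≤ b) (hφ : IntervalIntegrable φ volume a b)
    (h : ∀ᵐ x, x ∈ Set.Icc a b → deriv f x ≤ φ x) :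
    f b - f a ≤ ∫ x in a..b, φ x := by
  have hac := hf.absolutelyContinuousOnInterval a b
  rw [← hac.integral_deriv_eq_sub]
  refine intervalIntegral.integral_mono_ae_restrict hab hac.intervalIntegrable_deriv hφ
    ((ae_restrict_iff' measurableSet_Icc).2 h)

/-- Jensen's inequality for the increment of a locally Lipschitz function on the unit interval. -/
theorem LocallyLipschitz.ofReal_sub_sq_le_lintegral {u : ℝ → ℝ} (hu : LocallyLipschitz u) :
    ENNReal.ofReal ((u 1 - u 0) ^ 2) ≤
      ∫⁻ t in Set.Ioc (0 : ℝ) 1, ENNReal.ofReal (deriv u t ^ 2) := by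
  by_cases hfin : ∫⁻ t in Set.Ioc (0 : ℝ) 1, ENNReal.ofReal (deriv u t ^ 2) = ⊤
  · simp [hfin]
  have hmeas : Measurable fun t => deriv u t ^ 2 := (measurable_deriv u).pow_const 2
  have hInt : IntegrableOn (fun t => deriv u t ^ 2) (Set.Ioc (0 : ℝ) 1) := by
    refine ⟨hmeas.aestronglyMeasurable, ?_⟩
    rw [hasFiniteIntegral_iff_ofReal (ae_of_all _ fun t => sq_nonneg _)]
    exact lt_top_iff_ne_top.2 hfin
  rw [← ofReal_integral_eq_lintegral_ofReal hInt (ae_of_all _ fun t => sq_nonneg _),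
    ← intervalIntegral.integral_of_le zero_le_one]
  refine ENNReal.ofReal_le_ofReal ?_
  have hac := hu.absolutelyContinuousOnInterval 0 1
  have hd := hac.intervalIntegrable_deriv
  have hsq : IntervalIntegrable (fun t => deriv u t ^ 2) volume 0 1 :=
    (intervalIntegrable_iff_integrableOn_Ioc_of_le zero_le_one).2 hInt
  set c := u 1 - u 0 with hc
  have h2 : ∫ t in (0 : ℝ)..1, (2 * c * deriv u t - c ^ 2) = c ^ 2 := by
    rw [intervalIntegral.integral_sub (hd.const_mul _) intervalIntegrable_const,
      intervalIntegral.integral_const_mul, hac.integral_deriv_eq_sub, ← hc]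
    simp; ring
  rw [← h2]
  refine intervalIntegral.integral_mono zero_le_one
    ((hd.const_mul _).sub intervalIntegrable_const) hsq fun t => ?_
  nlinarith [sq_nonneg (deriv u t - c)]

theorem locallyLipschitz_of_hasDerivAt {S s : ℝ → ℝ} (hs : Continuous s)
    (hS : ∀ u, HasDerivAt S (s u) u) : LocallyLipschitz S := by
  refine ContDiff.locallyLipschitz (𝕂 := ℝ) (contDiff_one_iff_deriv.2
    ⟨fun u => (hS u).differentiableAt, ?_⟩)
  rwa [show deriv S = s from funext fun u => (hS u).deriv]

/-- The squared defect of `f` in the differential equation `f' = s(f)`. -/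
def sqDefect (s f : ℝ → ℝ) (x : ℝ) : ℝ := (deriv f x - s (f x)) ^ 2

theorem sqDefect_nonneg (s f : ℝ → ℝ) (x : ℝ) : 0 ≤ sqDefect s f x := sq_nonneg _

theorem integral_sqDefect_le {s f : ℝ → ℝ} (h : Integrable (sqDefect s f)) {a b : ℝ}
    (hab : a ≤ b) : ∫ x in a..b, sqDefect s f x ≤ ∫ x, sqDefect s f x := by
  rw [intervalIntegral.integral_of_le hab]
  exact setIntegral_le_integral h (ae_of_all _ (sqDefect_nonneg s f))

/-- A function with small defect is almost monotone when measured through a primitive of `s`. -/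
theorem primitive_sub_le_sqDefect {S s f : ℝ → ℝ} (hs : Continuous s)
    (hS : ∀ u, HasDerivAt S (s u) u) (hf : LocallyLipschitz f)
    (hInt : Integrable (sqDefect s f)) {a b : ℝ} (hab : a ≤ b) :
    S (f a) - S (f b) ≤ (∫ x, sqDefect s f x) / 4 := by
  have hL : LocallyLipschitz (fun x => -S (f x)) :=
    ((locallyLipschitz_of_hasDerivAt hs hS).comp hf).neg
  have h1 := hL.sub_le_integral (φ := fun x => sqDefect s f x / 4) hab
    (hInt.intervalIntegrable.div_const 4) ?_
  · have := integral_sqDefect_le hInt hab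
    rw [intervalIntegral.integral_div] at h1
    linarith
  · filter_upwards [hf.ae_differentiableAt] with x hfx _
    have : HasDerivAt (fun x => -S (f x)) (-(s (f x) * deriv f x)) x :=
      ((hS (f x)).comp x hfx.hasDerivAt).neg
    rw [this.deriv]
    unfold sqDefect
    nlinarith [sq_nonneg (deriv f x + s (f x))]

theorem primitive_sub_le_of_crossing_down {S s f : ℝ → ℝ} (hs : Continuous s)
    (hS : ∀ u, HasDerivAt S (s u) u) (hf : LocallyLipschitz f)
    (hInt : Integrable (sqDefect s f)) {a b u w : ℝ} (hab : a ≤ b) (hwu : w ≤ u)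
    (ha : u ≤ f a) (hb : f b ≤ w) : S u - S w ≤ (∫ x, sqDefect s f x) / 4 := by
  obtain ⟨a', ha', rfl⟩ := intermediate_value_Icc' hab hf.continuous.continuousOn
    ⟨hb.trans hwu, ha⟩
  obtain ⟨b', hb', rfl⟩ := intermediate_value_Icc' ha'.2 hf.continuous.continuousOn ⟨hb, hwu⟩
  exact primitive_sub_le_sqDefect hs hS hf hInt hb'.1

theorem primitive_sub_le_of_crossing_up {S s f : ℝ → ℝ} (hs : Continuous s)
    (hS : ∀ u, HasDerivAt S (s u) u) (hf : LocallyLipschitz f)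
    (hInt : Integrable (sqDefect s f)) {a b u w : ℝ} (hab : a ≤ b) (huw : u ≤ w)
    (ha : f a ≤ u) (hb : w ≤ f b) : S u - S w ≤ (∫ x, sqDefect s f x) / 4 := by
  obtain ⟨a', ha', rfl⟩ := intermediate_value_Icc hab hf.continuous.continuousOn
    ⟨ha, huw.trans hb⟩
  obtain ⟨b', hb', rfl⟩ := intermediate_value_Icc ha'.2 hf.continuous.continuousOn ⟨huw, hb⟩
  exact primitive_sub_le_sqDefect hs hS hf hInt hb'.1

/-- The vector field `s` is positive between the equilibria `-1` and `1`, negative above `1`,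
contracting at rate `κ` near `1` and one-sided Lipschitz with constant `Λ` on the way there. -/
structure IsForwardStable (s : ℝ → ℝ) (r κ Λ : ℝ) : Prop where
  cont : Continuous s
  pos : ∀ u ∈ Set.Ioo (-1 : ℝ) 1, 0 < s u
  neg : ∀ u, 1 < u → s u < 0
  r_pos : 0 < r
  r_le : r ≤ 1 / 2
  rate_pos : 0 < κ
  lip_nonneg : 0 ≤ Λ
  contracting : AntitoneOn (fun u => s u + κ * u) (Set.Icc (1 - r) (1 + r))
  oneSidedLip : AntitoneOn (fun u => s u - Λ * u) (Set.Icc (-1 / 2) (1 + r))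

theorem AntitoneOn.sub_mul_sub_le {s : ℝ → ℝ} {c : ℝ} {A : Set ℝ}
    (h : AntitoneOn (fun u => s u - c * u) A) {u w : ℝ} (hu : u ∈ A) (hw : w ∈ A) :
    (s u - s w) * (u - w) ≤ c * (u - w) ^ 2 := by
  rcases le_total u w with huw | huw
  · have := h hu hw huw
    simp only at this
    nlinarith
  · have := h hw hu huw
    simp only at this
    nlinarith

/-- Weighted energy estimate for the difference of a function with small defect and a solution. -/
theorem weighted_sq_sub_le {s f m : ℝ → ℝ} {β C a b : ℝ} (hab : a ≤ b) (hs : Continuous s)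
    (hf : LocallyLipschitz f) (hm : ∀ x, HasDerivAt m (s (m x)) x)
    (hInt : Integrable (sqDefect s f)) (hC : 0 ≤ C)
    (h : ∀ x ∈ Set.Icc a b, ∀ g : ℝ, 2 * (f x - m x) * (s (f x) + g - s (m x)) ≤
      β * (f x - m x) ^ 2 + C * g ^ 2) :
    (f b - m b) ^ 2 ≤ (f a - m a) ^ 2 + β * (∫ x in a..b, (f x - m x) ^ 2) +
      C * ∫ x, sqDefect s f x := by
  have hmc : Continuous m := continuous_iff_continuousAt.2 fun x => (hm x).continuousAt
  have hmL : LocallyLipschitz m := locallyLipschitz_of_hasDerivAt (hs.comp hmc) hm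
  have hv : LocallyLipschitz fun x => f x - m x := hf.sub hmL
  have hL : LocallyLipschitz fun x => (f x - m x) ^ 2 :=
    (ContDiff.locallyLipschitz (𝕂 := ℝ) (f := fun t : ℝ => t ^ 2) (by fun_prop)).comp hv
  have hi : IntervalIntegrable (fun x => (f x - m x) ^ 2) volume a b :=
    hL.continuous.intervalIntegrable _ _
  have h1 := hL.sub_le_integral hab (φ := fun x => β * (f x - m x) ^ 2 + C * sqDefect s f x)
    ((hi.const_mul β).add (hInt.intervalIntegrable.const_mul C)) ?_
  · rw [intervalIntegral.integral_add (hi.const_mul β) (hInt.intervalIntegrable.const_mul C),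
      intervalIntegral.integral_const_mul, intervalIntegral.integral_const_mul] at h1
    have := mul_le_mul_of_nonneg_left (integral_sqDefect_le hInt hab) hC
    linarith
  · filter_upwards [hf.ae_differentiableAt] with x hfx hx
    have h2 : HasDerivAt (fun x => (f x - m x) ^ 2)
        (2 * (f x - m x) * (deriv f x - s (m x))) x := by
      simpa using (hfx.hasDerivAt.fun_sub (hm x)).fun_pow 2
    rw [h2.deriv]
    have := h x hx (deriv f x - s (f x))
    unfold sqDefect
    rwa [add_sub_cancel] at this

/-- A function with small defect starting at `0` gets close to the equilibrium `1` in uniformly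
bounded time and stays there. -/
theorem IsForwardStable.exists_confinement {s : ℝ → ℝ} {r κ Λ : ℝ}
    (H : IsForwardStable s r κ Λ) :
    ∃ e₀ T : ℝ, 0 < e₀ ∧ 0 < T ∧ ∀ f : ℝ → ℝ, LocallyLipschitz f →
      Tendsto f atBot (𝓝 (-1)) → f 0 = 0 → Integrable (sqDefect s f) →
      (∫ x, sqDefect s f x) ≤ e₀ →
      (∀ x, 0 ≤ x → f x ∈ Set.Icc (-1 / 2) (1 + r)) ∧
      (∀ x, T ≤ x → f x ∈ Set.Icc (1 - r) (1 + r)) := by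
  have hs := H.cont
  have hr := H.r_pos
  have hr2 := H.r_le
  set S : ℝ → ℝ := fun u => ∫ v in (0 : ℝ)..u, s v with hSdef
  have hS : ∀ u, HasDerivAt S (s u) u := fun u =>
    intervalIntegral.integral_hasDerivAt_right (hs.intervalIntegrable _ _)
      (hs.stronglyMeasurableAtFilter _ _) hs.continuousAt
  have hSc : Continuous S := continuous_iff_continuousAt.2 fun u => (hS u).continuousAt
  have hinc : StrictMonoOn S (Set.Icc (-1) 1) :=
    strictMonoOn_of_deriv_pos (convex_Icc _ _) hSc.continuousOn fun x hx => by
      rw [(hS x).deriv]; exact H.pos x (by simpa using hx)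
  have hdec : StrictAntiOn S (Set.Ici 1) :=
    strictAntiOn_of_deriv_neg (convex_Ici _) hSc.continuousOn fun x hx => by
      rw [(hS x).deriv]; exact H.neg x (by simpa using hx)
  have g1 : 0 < S 1 - S (1 + r) :=
    sub_pos.2 (hdec (by simp) (by simp; linarith) (by linarith))
  have g2 : 0 < S 0 - S (-1 / 2) :=
    sub_pos.2 (hinc (by norm_num) (by norm_num) (by norm_num))
  have g3 : 0 < S (1 - r / 2) - S (1 - r) :=
    sub_pos.2 (hinc ⟨by linarith, by linarith⟩ ⟨by linarith, by linarith⟩ (by linarith))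
  obtain ⟨e₀, he₀, h1, h2, h3⟩ : ∃ e₀ : ℝ, 0 < e₀ ∧ e₀ / 4 < S 1 - S (1 + r) ∧
      e₀ / 4 < S 0 - S (-1 / 2) ∧ e₀ / 4 < S (1 - r / 2) - S (1 - r) := by
    refine ⟨min (S 1 - S (1 + r)) (min (S 0 - S (-1 / 2)) (S (1 - r / 2) - S (1 - r))),
      lt_min g1 (lt_min g2 g3), ?_⟩
    have a1 := min_le_left (S 1 - S (1 + r)) (min (S 0 - S (-1 / 2)) (S (1 - r / 2) - S (1 - r)))
    have a2 := min_le_right (S 1 - S (1 + r)) (min (S 0 - S (-1 / 2)) (S (1 - r / 2) - S (1 - r)))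
    have a3 := min_le_left (S 0 - S (-1 / 2)) (S (1 - r / 2) - S (1 - r))
    have a4 := min_le_right (S 0 - S (-1 / 2)) (S (1 - r / 2) - S (1 - r))
    refine ⟨by linarith, by linarith, by linarith⟩
  obtain ⟨u₀, hu₀, hmin⟩ := isCompact_Icc.exists_isMinOn
    (Set.nonempty_Icc.2 (by linarith : (-1 / 2 : ℝ) ≤ 1 - r / 2)) hs.continuousOn
  set σ := s u₀ with hσ
  have hσpos : 0 < σ := H.pos u₀ ⟨by linarith [hu₀.1], by linarith [hu₀.2]⟩
  set T := 2 / σ * (1 + e₀ / (2 * σ)) with hT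
  have hTpos : 0 < T := by positivity
  refine ⟨e₀, T, he₀, hTpos, fun f hf hbot hf0 hInt hE => ?_⟩
  set E := ∫ x, sqDefect s f x with hEdef
  have hup : ∀ x, f x ≤ 1 + r := fun x => by
    by_contra! hx
    obtain ⟨y, hy, hyx⟩ := ((hbot.eventually_lt_const (by norm_num : (-1 : ℝ) < 1)).and
      (eventually_le_atBot x)).exists
    have := primitive_sub_le_of_crossing_up hs hS hf hInt hyx (by linarith : (1 : ℝ) ≤ 1 + r)
      hy.le hx.le
    linarith
  have hlow : ∀ x, 0 ≤ x → -1 / 2 ≤ f x := fun x hx0 => by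
    by_contra! hx
    have := primitive_sub_le_of_crossing_down hs hS hf hInt hx0
      (by norm_num : (-1 / 2 : ℝ) ≤ 0) hf0.ge hx.le
    linarith
  obtain ⟨x₁, hx₁, hfx₁⟩ : ∃ x₁ ∈ Set.Icc 0 T, 1 - r / 2 ≤ f x₁ := by
    by_contra! hcon
    have hL : LocallyLipschitz fun x => -f x := hf.neg
    have hi : IntervalIntegrable (fun x => 1 / (2 * σ) * sqDefect s f x) volume 0 T :=
      hInt.intervalIntegrable.const_mul _
    have h4 := hL.sub_le_integral hTpos.le
      (φ := fun x => 1 / (2 * σ) * sqDefect s f x - σ / 2)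
      (hi.sub intervalIntegrable_const) ?_
    · rw [intervalIntegral.integral_sub hi intervalIntegrable_const,
        intervalIntegral.integral_const_mul, intervalIntegral.integral_const] at h4
      have h5 := mul_le_mul_of_nonneg_left ((integral_sqDefect_le hInt hTpos.le).trans hE)
        (by positivity : 0 ≤ 1 / (2 * σ))
      have h6 := hcon T ⟨hTpos.le, le_rfl⟩
      have h7 : (T - 0) • (σ / 2) = 1 + 1 / (2 * σ) * e₀ := by
        rw [hT, smul_eq_mul]; field_simp; ring
      rw [h7] at h4
      linarith
    · filter_upwards [hf.ae_differentiableAt] with x hfx hx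
      have h4 : HasDerivAt (fun x => -f x) (-deriv f x) x := hfx.hasDerivAt.neg
      rw [h4.deriv]
      have h5 : σ ≤ s (f x) := hmin ⟨hlow x hx.1, (hcon x hx).le⟩
      unfold sqDefect
      have h6 : 0 ≤ 1 / (2 * σ) * (deriv f x - s (f x) + σ) ^ 2 := by positivity
      have h7 : 1 / (2 * σ) * (deriv f x - s (f x) + σ) ^ 2 =
          1 / (2 * σ) * (deriv f x - s (f x)) ^ 2 + (deriv f x - s (f x)) + σ / 2 := by
        field_simp; ring
      linarith
  refine ⟨fun x hx => ⟨hlow x hx, hup x⟩, fun x hx => ⟨?_, hup x⟩⟩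
  by_contra! hx'
  have := primitive_sub_le_of_crossing_down hs hS hf hInt (hx₁.2.trans hx)
    (by linarith : 1 - r ≤ 1 - r / 2) hfx₁ hx'.le
  linarith

/-- A solution of `m' = s(m)` connecting the equilibria `-1` and `1`. -/
structure IsConnection (s m : ℝ → ℝ) : Prop where
  mem_Icc : ∀ x, m x ∈ Set.Icc (-1 : ℝ) 1
  ode : ∀ x, HasDerivAt m (s (m x)) x
  limit_top : Tendsto m atTop (𝓝 1)
  limit_bot : Tendsto m atBot (𝓝 (-1))
  zero : m 0 = 0

theorem IsConnection.continuous {s m : ℝ → ℝ} (hm : IsConnection s m) : Continuous m :=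
  continuous_iff_continuousAt.2 fun x => (hm.ode x).continuousAt

/-- Quantitative stability of the connecting orbit on the positive half-line. -/
theorem IsForwardStable.exists_halfline_stability {s m : ℝ → ℝ} {r κ Λ : ℝ}
    (H : IsForwardStable s r κ Λ) (hm : IsConnection s m) (hs0 : ∀ u ∈ Set.Icc (-1 : ℝ) 1, 0 ≤ s u) :
    ∃ e₀ C : ℝ, 0 < e₀ ∧ 0 ≤ C ∧ ∀ f : ℝ → ℝ, LocallyLipschitz f →
      Tendsto f atBot (𝓝 (-1)) → f 0 = 0 → Integrable (sqDefect s f) →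
      (∫ x, sqDefect s f x) ≤ e₀ → ∀ R, 0 ≤ R →
      ∫ x in (0 : ℝ)..R, (f x - m x) ^ 2 ≤ C * ∫ x, sqDefect s f x := by
  obtain ⟨e₀, T₁, he₀, hT₁, hconf⟩ := H.exists_confinement
  have hr := H.r_pos
  have hκ := H.rate_pos
  have hΛ := H.lip_nonneg
  have hmono : Monotone m := monotone_of_hasDerivAt_nonneg hm.ode fun x => hs0 _ (hm.mem_Icc x)
  have hm_nonneg : ∀ x, 0 ≤ x → m x ∈ Set.Icc (-1 / 2) (1 + r) := fun x hx => by
    have := hmono hx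
    rw [hm.zero] at this
    exact ⟨by linarith, by linarith [(hm.mem_Icc x).2]⟩
  obtain ⟨T₂, hT₂⟩ := ((hm.limit_top.eventually_const_lt (by linarith : 1 - r < 1))).exists
  set T := max T₁ T₂
  have hT : 0 < T := hT₁.trans_le (le_max_left _ _)
  have hm_near : ∀ x, T ≤ x → m x ∈ Set.Icc (1 - r) (1 + r) := fun x hx =>
    ⟨hT₂.le.trans (hmono ((le_max_right _ _).trans hx)), by linarith [(hm.mem_Icc x).2]⟩
  set β := 2 * Λ + 1
  have hβ : 0 < β := by positivity
  set G := 1 / β * (Real.exp (β * T) - 1) with hG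
  have hGnn : 0 ≤ G := by
    have := Real.one_le_exp (mul_pos hβ hT).le
    have : 0 ≤ Real.exp (β * T) - 1 := by linarith
    positivity
  refine ⟨e₀, G + (β * G + 1 + 1 / κ) / κ, he₀, by positivity,
    fun f hf hbot hf0 hInt hE R hR => ?_⟩
  obtain ⟨hc1, hc2⟩ := hconf f hf hbot hf0 hInt hE
  set E := ∫ x, sqDefect s f x
  have hEnn : 0 ≤ E := integral_nonneg (sqDefect_nonneg s f)
  have hVc : Continuous fun x => (f x - m x) ^ 2 := (hf.continuous.sub hm.continuous).pow 2
  set V : ℝ → ℝ := fun x => (f x - m x) ^ 2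
  set W : ℝ → ℝ := fun x => ∫ t in (0 : ℝ)..x, V t
  have hVnn : ∀ x, 0 ≤ V x := fun x => sq_nonneg _
  have hW : ∀ x, HasDerivAt W (V x) x := fun x =>
    intervalIntegral.integral_hasDerivAt_right (hVc.intervalIntegrable _ _)
      (hVc.stronglyMeasurableAtFilter _ _) hVc.continuousAt
  have hWmono : Monotone W := monotone_of_hasDerivAt_nonneg hW hVnn
  have hW0 : W 0 = 0 := intervalIntegral.integral_same
  have hstep1 : ∀ x, 0 ≤ x → V x ≤ β * W x + E := fun x hx => by
    have := weighted_sq_sub_le (β := β) (C := 1) hx H.cont hf hm.ode hInt zero_le_one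
      fun y hy g => by
        have h1 := AntitoneOn.sub_mul_sub_le H.oneSidedLip (hc1 y hy.1) (hm_nonneg y hy.1)
        simp only [β]
        nlinarith [sq_nonneg (f y - m y - g)]
    rw [hf0, hm.zero] at this
    simpa [V, W] using this
  have hWT : W T ≤ G * E := by
    have := norm_le_gronwallBound_of_norm_deriv_right_le (f := W) (f' := V) (δ := 0) (K := β)
      (ε := E) (a := 0) (b := T) (fun x _ => (hW x).continuousAt.continuousWithinAt)
      (fun x _ => (hW x).hasDerivWithinAt) (by simp [hW0]) (fun x hx => by
        have h1 := hstep1 x hx.1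
        have h2 : 0 ≤ W x := hW0 ▸ hWmono hx.1
        rwa [Real.norm_of_nonneg (hVnn x), Real.norm_of_nonneg h2]) T ⟨hT.le, le_rfl⟩
    rw [gronwallBound_of_K_ne_0 hβ.ne'] at this
    have h3 := (le_abs_self (W T)).trans this
    calc W T ≤ _ := h3
      _ = G * E := by rw [hG]; simp; ring
  have hVT : V T ≤ (β * G + 1) * E := by
    have := hstep1 T hT.le
    nlinarith [mul_le_mul_of_nonneg_left hWT hβ.le]
  have htail : ∀ R, T ≤ R → W R ≤ (G + (β * G + 1 + 1 / κ) / κ) * E := fun R hTR => by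
    have h1 := weighted_sq_sub_le (β := -κ) (C := 1 / κ) hTR H.cont hf hm.ode hInt (by positivity)
      fun y hy g => by
        have h1 := AntitoneOn.sub_mul_sub_le (c := -κ) (by simpa using H.contracting)
          (hc2 y ((le_max_left _ _).trans hy.1)) (hm_near y hy.1)
        have h2 : 0 ≤ 1 / κ * (κ * (f y - m y) - g) ^ 2 := by positivity
        have h3 : 1 / κ * (κ * (f y - m y) - g) ^ 2 =
          κ * (f y - m y) ^ 2 - 2 * (f y - m y) * g + 1 / κ * g ^ 2 := by
            field_simp; ring
        nlinarith
    have h2 : ∫ t in T..R, V t = W R - W T :=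
      (intervalIntegral.integral_interval_sub_left (hVc.intervalIntegrable _ _)
        (hVc.intervalIntegrable _ _)).symm
    have h3 : 0 ≤ V R := hVnn R
    have h4 : κ * (W R - W T) ≤ (β * G + 1 + 1 / κ) * E := by
      rw [← h2]
      simp only [V] at h3 hVT ⊢
      linarith
    have h5 : W R - W T ≤ (β * G + 1 + 1 / κ) * E / κ := by
      rw [le_div_iff₀ hκ]; linarith
    calc W R ≤ G * E + (β * G + 1 + 1 / κ) * E / κ := by linarith
      _ = _ := by ring
  exact (hWmono (le_max_left R T)).trans (htail _ (le_max_right R T))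

/-- Reflecting a function and its argument preserves the defect of an even vector field. -/
theorem sqDefect_reflect {s f : ℝ → ℝ} (hs : ∀ u, s (-u) = s u) :
    sqDefect s (fun x => -f (-x)) = fun x => sqDefect s f (-x) := by
  funext x
  have : deriv (fun x => -f (-x)) x = deriv f (-x) := by
    rw [deriv.fun_neg, deriv_comp_neg, neg_neg]
  simp [sqDefect, this, hs]

theorem sqDefect_translate {s f : ℝ → ℝ} (ξ : ℝ) :
    sqDefect s (fun x => f (x + ξ)) = fun x => sqDefect s f (x + ξ) := by
  funext x
  simp [sqDefect, deriv_comp_add_const]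

theorem IsConnection.reflect {s m : ℝ → ℝ} (hs : ∀ u, s (-u) = s u) (hm : IsConnection s m) :
    IsConnection s fun x => -m (-x) where
  mem_Icc x := ⟨neg_le_neg (hm.mem_Icc (-x)).2, by linarith [(hm.mem_Icc (-x)).1]⟩
  ode x := by
    rw [hs]
    have := ((hm.ode (-x)).comp x (hasDerivAt_neg x)).fun_neg
    simpa [Function.comp_def] using this
  limit_top := by
    simpa using (hm.limit_bot.comp tendsto_neg_atTop_atBot).neg
  limit_bot := (hm.limit_top.comp tendsto_neg_atBot_atTop).neg
  zero := by simp [hm.zero]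

/-- Quantitative stability of the connecting orbit, up to translation. -/
theorem IsForwardStable.exists_stability {s m : ℝ → ℝ} {r κ Λ : ℝ}
    (H : IsForwardStable s r κ Λ) (hs : ∀ u, s (-u) = s u) (hm : IsConnection s m)
    (hs0 : ∀ u ∈ Set.Icc (-1 : ℝ) 1, 0 ≤ s u) :
    ∃ e₀ C : ℝ, 0 < e₀ ∧ 0 ≤ C ∧ ∀ f : ℝ → ℝ, LocallyLipschitz f →
      Tendsto f atTop (𝓝 1) → Tendsto f atBot (𝓝 (-1)) → Integrable (sqDefect s f) →
      (∫ x, sqDefect s f x) ≤ e₀ → ∃ ξ : ℝ,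
      ∫⁻ x, ENNReal.ofReal ((f x - m (x - ξ)) ^ 2) ≤
        ENNReal.ofReal (C * ∫ x, sqDefect s f x) := by
  obtain ⟨e₁, C₁, he₁, hC₁, h₁⟩ := H.exists_halfline_stability hm hs0
  obtain ⟨e₂, C₂, he₂, hC₂, h₂⟩ := H.exists_halfline_stability (hm.reflect hs) hs0
  refine ⟨min e₁ e₂, C₁ + C₂, lt_min he₁ he₂, by positivity, fun f hf htop hbot hInt hE => ?_⟩
  obtain ⟨ξ, hξ⟩ : ∃ ξ, f ξ = 0 := by
    obtain ⟨a, ha⟩ := (hbot.eventually_lt_const (by norm_num : (-1 : ℝ) < 0)).exists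
    obtain ⟨b, hb⟩ := (htop.eventually_const_lt (by norm_num : (0 : ℝ) < 1)).exists
    exact mem_range_of_exists_le_of_exists_ge hf.continuous ⟨a, ha.le⟩ ⟨b, hb.le⟩
  refine ⟨ξ, ?_⟩
  set E := ∫ x, sqDefect s f x with hEdef
  set f₁ : ℝ → ℝ := fun x => f (x + ξ)
  set f₂ : ℝ → ℝ := fun x => -f₁ (-x)
  have hf₁ : LocallyLipschitz f₁ :=
    hf.comp (ContDiff.locallyLipschitz (𝕂 := ℝ) (f := fun x : ℝ => x + ξ) (by fun_prop))
  have hf₂ : LocallyLipschitz f₂ :=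
    (hf₁.comp (ContDiff.locallyLipschitz (𝕂 := ℝ) (f := fun x : ℝ => -x) (by fun_prop))).neg
  have hInt₁ : Integrable (sqDefect s f₁) := by
    rw [sqDefect_translate]; exact hInt.comp_add_right ξ
  have hInt₂ : Integrable (sqDefect s f₂) := by
    rw [sqDefect_reflect hs]; exact hInt₁.comp_neg
  have hE₁ : ∫ x, sqDefect s f₁ x = E := by
    rw [sqDefect_translate]; exact integral_add_right_eq_self _ ξ
  have hE₂ : ∫ x, sqDefect s f₂ x = E := by
    rw [sqDefect_reflect hs, integral_neg_eq_self, hE₁]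
  have hf₁0 : f₁ 0 = 0 := by simp [f₁, hξ]
  have hbot₁ : Tendsto f₁ atBot (𝓝 (-1)) := hbot.comp (tendsto_atBot_add_const_right _ ξ tendsto_id)
  have htop₁ : Tendsto f₁ atTop (𝓝 1) := htop.comp (tendsto_atTop_add_const_right _ ξ tendsto_id)
  have hbot₂ : Tendsto f₂ atBot (𝓝 (-1)) := (htop₁.comp tendsto_neg_atBot_atTop).neg
  have hcont : Continuous fun x => (f₁ x - m x) ^ 2 := (hf₁.continuous.sub hm.continuous).pow 2
  have hbound : ∀ n : ℕ, ∫⁻ x in Set.Ioc (-(n : ℝ)) n, ENNReal.ofReal ((f₁ x - m x) ^ 2) ≤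
      ENNReal.ofReal ((C₁ + C₂) * E) := fun n => by
    have hn : (0 : ℝ) ≤ n := Nat.cast_nonneg n
    have hi : IntegrableOn (fun x => (f₁ x - m x) ^ 2) (Set.Ioc (-(n : ℝ)) n) :=
      (hcont.integrableOn_Icc).mono_set Set.Ioc_subset_Icc_self
    rw [← ofReal_integral_eq_lintegral_ofReal hi (ae_of_all _ fun x => sq_nonneg _),
      ← intervalIntegral.integral_of_le (by linarith)]
    refine ENNReal.ofReal_le_ofReal ?_
    rw [← intervalIntegral.integral_add_adjacent_intervals (b := 0)
      (hcont.intervalIntegrable _ _) (hcont.intervalIntegrable _ _)]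
    have b1 := h₁ f₁ hf₁ hbot₁ hf₁0 hInt₁ (by rw [hE₁]; exact hE.trans (min_le_left _ _)) n hn
    have b2 := h₂ f₂ hf₂ hbot₂ (by simp [f₂, hf₁0]) hInt₂
      (by rw [hE₂]; exact hE.trans (min_le_right _ _)) n hn
    have b3 : ∫ x in (0 : ℝ)..n, (f₂ x - -m (-x)) ^ 2 =
        ∫ x in (-(n : ℝ))..0, (f₁ x - m x) ^ 2 := by
      have := intervalIntegral.integral_comp_neg (a := 0) (b := n) fun x => (f₁ x - m x) ^ 2
      rw [neg_zero] at this
      rw [← this]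
      refine intervalIntegral.integral_congr fun x _ => ?_
      simp only [f₂]
      ring
    rw [b3, hE₂] at b2
    rw [hE₁] at b1
    linarith
  have hshift : ∫⁻ x, ENNReal.ofReal ((f x - m (x - ξ)) ^ 2) =
      ∫⁻ x, ENNReal.ofReal ((f₁ x - m x) ^ 2) := by
    rw [← lintegral_add_right_eq_self _ ξ]
    simp [f₁]
  rw [hshift, ← setLIntegral_univ]
  have hU : (⋃ n : ℕ, Set.Ioc (-(n : ℝ)) n) = Set.univ := by
    refine Set.eq_univ_of_forall fun x => Set.mem_iUnion.2 ?_
    obtain ⟨n, hn⟩ := exists_nat_gt |x|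
    exact ⟨n, (abs_lt.1 hn).1, (abs_lt.1 hn).2.le⟩
  rw [← hU, setLIntegral_iUnion_of_directed]
  · exact iSup_le hbound
  · refine Monotone.directed_le fun a b hab => ?_
    have : (a : ℝ) ≤ b := Nat.cast_le.2 hab
    exact Set.Ioc_subset_Ioc (by linarith) this

/-- The square root of `2F`, with the sign making both wells hyperbolic equilibria. -/
def signedRoot (F : ℝ → ℝ) (u : ℝ) : ℝ :=
  if |u| ≤ 1 then Real.sqrt (2 * F u) else -Real.sqrt (2 * F u)

theorem signedRoot_of_mem {F : ℝ → ℝ} {u : ℝ} (hu : u ∈ Set.Icc (-1 : ℝ) 1) :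
    signedRoot F u = Real.sqrt (2 * F u) := if_pos (abs_le.2 hu)

theorem signedRoot_of_one_lt {F : ℝ → ℝ} {u : ℝ} (hu : 1 < u) :
    signedRoot F u = -Real.sqrt (2 * F u) := if_neg (not_le.2 (hu.trans_le (le_abs_self u)))

namespace IsStdPotential

variable {F : ℝ → ℝ}

theorem eq_zero_of_abs {u : ℝ} (hF : IsStdPotential F) (hu : |u| = 1) : F u = 0 :=
  (hF.zero_iff u).2 (eq_or_eq_neg_of_abs_eq hu)

theorem pos_of_abs_ne {u : ℝ} (hF : IsStdPotential F) (hu : |u| ≠ 1) : 0 < F u := by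
  refine (hF.nonneg u).lt_of_ne' fun h => hu ?_
  rcases (hF.zero_iff u).1 h with rfl | rfl <;> simp

theorem differentiable (hF : IsStdPotential F) : Differentiable ℝ F :=
  hF.smooth.differentiable (by norm_num)

theorem contDiff_deriv (hF : IsStdPotential F) : ContDiff ℝ 1 (deriv F) :=
  (contDiff_succ_iff_deriv.1 (hF.smooth.of_le (by norm_num : (1 : WithTop ℕ∞) + 1 ≤ 3))).2.2

theorem signedRoot_sq (hF : IsStdPotential F) (u : ℝ) : signedRoot F u ^ 2 = 2 * F u := by
  have h : 0 ≤ 2 * F u := by linarith [hF.nonneg u]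
  unfold signedRoot
  split_ifs
  · rw [Real.sq_sqrt h]
  · rw [neg_sq, Real.sq_sqrt h]

theorem signedRoot_neg (hF : IsStdPotential F) (u : ℝ) : signedRoot F (-u) = signedRoot F u := by
  simp [signedRoot, hF.symm]

theorem continuous_signedRoot (hF : IsStdPotential F) : Continuous (signedRoot F) := by
  have hc : Continuous fun u => Real.sqrt (2 * F u) :=
    (continuous_const.mul hF.differentiable.continuous).sqrt
  refine hc.if_le hc.neg continuous_abs continuous_const fun u hu => ?_
  simp [hF.eq_zero_of_abs hu]

theorem hasDerivAt_sqrt {u : ℝ} (hF : IsStdPotential F) (hu : |u| ≠ 1) :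
    HasDerivAt (fun u => Real.sqrt (2 * F u)) (deriv F u / Real.sqrt (2 * F u)) u := by
  have h := ((hF.differentiable u).hasDerivAt.const_mul 2).sqrt
    (by linarith [hF.pos_of_abs_ne hu])
  convert h using 1
  ring

theorem hasDerivAt_signedRoot_of_mem {u : ℝ} (hF : IsStdPotential F)
    (hu : u ∈ Set.Ioo (-1 : ℝ) 1) :
    HasDerivAt (signedRoot F) (deriv F u / Real.sqrt (2 * F u)) u := by
  refine (hF.hasDerivAt_sqrt (abs_lt.2 hu).ne).congr_of_eventuallyEq ?_
  filter_upwards [isOpen_Ioo.mem_nhds hu] with v hv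
  exact signedRoot_of_mem ⟨hv.1.le, hv.2.le⟩

theorem hasDerivAt_signedRoot_of_one_lt {u : ℝ} (hF : IsStdPotential F) (hu : 1 < u) :
    HasDerivAt (signedRoot F) (-(deriv F u / Real.sqrt (2 * F u))) u := by
  refine (hF.hasDerivAt_sqrt (hu.trans_le (le_abs_self u)).ne').fun_neg.congr_of_eventuallyEq ?_
  filter_upwards [isOpen_Ioi.mem_nhds hu] with v hv
  exact signedRoot_of_one_lt hv

/-- Nondegeneracy of the well at `1`. -/
theorem exists_deriv_bounds (hF : IsStdPotential F) :
    ∃ r κ : ℝ, 0 < r ∧ r ≤ 1 / 2 ∧ 0 < κ ∧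
      (∀ u ∈ Set.Ioo (1 - r) 1, deriv F u / Real.sqrt (2 * F u) ≤ -κ) ∧
      ∀ u ∈ Set.Ioo 1 (1 + r), κ ≤ deriv F u / Real.sqrt (2 * F u) := by
  obtain ⟨hd, hdd⟩ := contDiff_one_iff_deriv.1 hF.contDiff_deriv
  set a := deriv (deriv F) 1 with ha
  have hapos : 0 < a := hF.dd_one_pos
  obtain ⟨r₀, hr₀, hball⟩ := Metric.eventually_nhds_iff.1
    (hdd.continuousAt.eventually_const_lt (by linarith : a / 2 < deriv (deriv F) 1))
  set r := min (r₀ / 2) (1 / 2)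
  have hrpos : 0 < r := by positivity
  have hr_lt : r < r₀ := (min_le_left _ _).trans_lt (by linarith)
  have hlow : ∀ u ∈ Set.Icc (1 - r) (1 + r), a / 2 < deriv (deriv F) u := fun u hu =>
    hball (by rw [Real.dist_eq, abs_lt]; constructor <;> linarith [hu.1, hu.2])
  have hd1 : deriv F 1 = 0 := (hF.deriv_zero_iff 1).2 (by simp)
  have hF1 : F 1 = 0 := hF.eq_zero_of_abs (by simp)
  have hmono : StrictMonoOn (deriv F) (Set.Icc (1 - r) (1 + r)) :=
    strictMonoOn_of_deriv_pos (convex_Icc _ _) hd.continuous.continuousOn fun x hx =>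
      (by positivity : (0 : ℝ) < a / 2).trans (hlow x (interior_subset hx))
  have h1mem : (1 : ℝ) ∈ Set.Icc (1 - r) (1 + r) := ⟨by linarith, by linarith⟩
  set φ : ℝ → ℝ := fun u => deriv F u ^ 2 - a * F u with hφ
  have hφd : ∀ u, HasDerivAt φ (2 * deriv F u * (deriv (deriv F) u - a / 2)) u := fun u => by
    have := ((hd u).hasDerivAt.fun_pow 2).fun_sub ((hF.differentiable u).hasDerivAt.const_mul a)
    refine this.congr_deriv ?_
    push_cast
    ring
  have hφc : Continuous φ := continuous_iff_continuousAt.2 fun u => (hφd u).continuousAt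
  have hφ1 : φ 1 = 0 := by simp [hφ, hd1, hF1]
  have hκ : 0 < Real.sqrt (a / 2) := by positivity
  have hφnn : ∀ u ∈ Set.Icc (1 - r) (1 + r), 0 ≤ φ u := fun u hu => by
    rcases le_total u 1 with h | h
    · have : AntitoneOn φ (Set.Icc (1 - r) 1) := by
        refine antitoneOn_of_deriv_nonpos (convex_Icc _ _) hφc.continuousOn
          (fun x _ => (hφd x).differentiableAt.differentiableWithinAt) fun x hx => ?_
        rw [interior_Icc] at hx
        have hx' : x ∈ Set.Icc (1 - r) (1 + r) := ⟨hx.1.le, by linarith [hx.2]⟩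
        have h1 := hmono hx' h1mem hx.2
        have h2 := hlow x hx'
        rw [(hφd x).deriv]
        nlinarith
      rw [← hφ1]
      exact this ⟨hu.1, h⟩ ⟨by linarith, le_rfl⟩ h
    · have : MonotoneOn φ (Set.Icc 1 (1 + r)) := by
        refine monotoneOn_of_deriv_nonneg (convex_Icc _ _) hφc.continuousOn
          (fun x _ => (hφd x).differentiableAt.differentiableWithinAt) fun x hx => ?_
        rw [interior_Icc] at hx
        have hx' : x ∈ Set.Icc (1 - r) (1 + r) := ⟨by linarith [hx.1], hx.2.le⟩
        have h1 := hmono h1mem hx' hx.1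
        have h2 := hlow x hx'
        rw [(hφd x).deriv]
        have : 0 ≤ deriv F x := by linarith
        have : 0 ≤ deriv (deriv F) x - a / 2 := by linarith
        positivity
      rw [← hφ1]
      exact this ⟨le_rfl, by linarith⟩ ⟨h, hu.2⟩ h
  have habs : ∀ u ∈ Set.Icc (1 - r) (1 + r),
      Real.sqrt (a / 2) * Real.sqrt (2 * F u) ≤ |deriv F u| := fun u hu => by
    rw [← Real.sqrt_mul (by positivity), ← Real.sqrt_sq_eq_abs]
    refine Real.sqrt_le_sqrt ?_
    have := hφnn u hu
    simp only [hφ] at this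
    linarith
  refine ⟨r, Real.sqrt (a / 2), hrpos, min_le_right _ _, hκ, fun u hu => ?_, fun u hu => ?_⟩
  · have hu' : u ∈ Set.Icc (1 - r) (1 + r) := ⟨hu.1.le, by linarith [hu.2]⟩
    have hr2 : r ≤ 1 / 2 := min_le_right _ _
    have hne : |u| ≠ 1 := by
      rw [abs_of_nonneg (by linarith [hu.1])]; exact hu.2.ne
    have h1 := hmono hu' h1mem hu.2
    have h2 := habs u hu'
    rw [abs_of_neg (by linarith)] at h2
    rw [div_le_iff₀ (Real.sqrt_pos.2 (by linarith [hF.pos_of_abs_ne hne]))]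
    linarith
  · have hu' : u ∈ Set.Icc (1 - r) (1 + r) := ⟨by linarith [hu.1], hu.2.le⟩
    have hne : |u| ≠ 1 := by
      rw [abs_of_nonneg (by linarith [hu.1])]; exact hu.1.ne'
    have h1 := hmono h1mem hu' hu.1
    have h2 := habs u hu'
    rw [abs_of_pos (by linarith)] at h2
    rwa [le_div_iff₀ (Real.sqrt_pos.2 (by linarith [hF.pos_of_abs_ne hne]))]

theorem exists_isForwardStable (hF : IsStdPotential F) :
    ∃ r κ Λ : ℝ, IsForwardStable (signedRoot F) r κ Λ := by
  obtain ⟨r, κ, hr, hr2, hκ, hleft, hright⟩ := hF.exists_deriv_bounds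
  have hc := hF.continuous_signedRoot
  have hcontr : AntitoneOn (fun u => signedRoot F u + κ * u) (Set.Icc (1 - r) (1 + r)) := by
    have hcc : Continuous fun u => signedRoot F u + κ * u := by fun_prop
    have hl : ∀ x ∈ interior (Set.Icc (1 - r) 1), HasDerivAt (fun u => signedRoot F u + κ * u)
        (deriv F x / Real.sqrt (2 * F x) + κ) x := fun x hx => by
      rw [interior_Icc] at hx
      simpa using (hF.hasDerivAt_signedRoot_of_mem ⟨by linarith [hx.1], hx.2⟩).fun_add
        ((hasDerivAt_id x).const_mul κ)
    have hu : ∀ x ∈ interior (Set.Icc 1 (1 + r)), HasDerivAt (fun u => signedRoot F u + κ * u)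
        (-(deriv F x / Real.sqrt (2 * F x)) + κ) x := fun x hx => by
      rw [interior_Icc] at hx
      simpa using (hF.hasDerivAt_signedRoot_of_one_lt hx.1).fun_add
        ((hasDerivAt_id x).const_mul κ)
    have h1 : AntitoneOn (fun u => signedRoot F u + κ * u) (Set.Icc (1 - r) 1) :=
      antitoneOn_of_deriv_nonpos (convex_Icc _ _) hcc.continuousOn
        (fun x hx => (hl x hx).differentiableAt.differentiableWithinAt) fun x hx => by
          rw [(hl x hx).deriv]
          rw [interior_Icc] at hx
          linarith [hleft x hx]
    have h2 : AntitoneOn (fun u => signedRoot F u + κ * u) (Set.Icc 1 (1 + r)) :=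
      antitoneOn_of_deriv_nonpos (convex_Icc _ _) hcc.continuousOn
        (fun x hx => (hu x hx).differentiableAt.differentiableWithinAt) fun x hx => by
          rw [(hu x hx).deriv]
          rw [interior_Icc] at hx
          linarith [hright x hx]
    have := h1.union_right h2 (isGreatest_Icc (by linarith)) (isLeast_Icc (by linarith))
    rwa [Set.Icc_union_Icc_eq_Icc (by linarith) (by linarith)] at this
  have hne : ∀ x ∈ Set.Icc (-1 / 2) (1 - r), |x| ≠ 1 := fun x hx =>
    (abs_lt.2 ⟨by linarith [hx.1], by linarith [hx.2]⟩).ne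
  have hdc : ContinuousOn (fun x => deriv F x / Real.sqrt (2 * F x)) (Set.Icc (-1 / 2) (1 - r)) :=
    hF.contDiff_deriv.continuous.continuousOn.div
      (continuous_const.mul hF.differentiable.continuous).sqrt.continuousOn fun x hx =>
        (Real.sqrt_pos.2 (by linarith [hF.pos_of_abs_ne (hne x hx)])).ne'
  obtain ⟨Λ₀, hΛ₀⟩ := isCompact_Icc.bddAbove_image hdc
  have hbd : ∀ x ∈ Set.Icc (-1 / 2) (1 - r), deriv F x / Real.sqrt (2 * F x) ≤ max Λ₀ 0 :=
    fun x hx => (hΛ₀ (Set.mem_image_of_mem _ hx)).trans (le_max_left _ _)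
  set Λ := max Λ₀ 0
  have hΛ : 0 ≤ Λ := le_max_right _ _
  refine ⟨r, κ, Λ, hc, fun u hu => ?_, fun u hu => ?_, hr, hr2, hκ, hΛ, hcontr, ?_⟩
  · rw [signedRoot_of_mem ⟨hu.1.le, hu.2.le⟩]
    exact Real.sqrt_pos.2 (by linarith [hF.pos_of_abs_ne (abs_lt.2 hu).ne])
  · rw [signedRoot_of_one_lt hu, neg_lt_zero]
    exact Real.sqrt_pos.2 (by linarith [hF.pos_of_abs_ne (hu.trans_le (le_abs_self u)).ne'])
  · have hl : ∀ x ∈ interior (Set.Icc (-1 / 2) (1 - r)),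
        HasDerivAt (fun u => signedRoot F u - Λ * u)
          (deriv F x / Real.sqrt (2 * F x) - Λ) x := fun x hx => by
      rw [interior_Icc] at hx
      simpa using (hF.hasDerivAt_signedRoot_of_mem
        ⟨by linarith [hx.1], by linarith [hx.2]⟩).fun_sub ((hasDerivAt_id x).const_mul Λ)
    have h1 : AntitoneOn (fun u => signedRoot F u - Λ * u) (Set.Icc (-1 / 2) (1 - r)) :=
      antitoneOn_of_deriv_nonpos (convex_Icc _ _) (by fun_prop)
        (fun x hx => (hl x hx).differentiableAt.differentiableWithinAt) fun x hx => by
          rw [(hl x hx).deriv]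
          linarith [hbd x (interior_subset hx)]
    have h2 : AntitoneOn (fun u => signedRoot F u - Λ * u) (Set.Icc (1 - r) (1 + r)) :=
      fun x hx y hy hxy => by
        have h3 := hcontr hx hy hxy
        have h4 := mul_le_mul_of_nonneg_left hxy (add_nonneg hκ.le hΛ)
        simp only at h3 ⊢
        linarith
    have := h1.union_right h2 (isGreatest_Icc (by linarith)) (isLeast_Icc (by linarith))
    rwa [Set.Icc_union_Icc_eq_Icc (by linarith) (by linarith)] at this

end IsStdPotential

theorem IsProfile.isConnection {F m : ℝ → ℝ} (hm : IsProfile F m) :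
    IsConnection (signedRoot F) m where
  mem_Icc := hm.mem_Icc
  ode x := by
    rw [signedRoot_of_mem (hm.mem_Icc x)]; exact hm.ode x
  limit_top := hm.limit_top
  limit_bot := hm.limit_bot
  zero := hm.zero

/-- Completing the square in the one-dimensional energy. -/
theorem IsStdPotential.ofReal_Cstar_add_le {F f : ℝ → ℝ} (hF : IsStdPotential F)
    (hf : LocallyLipschitz f) (htop : Tendsto f atTop (𝓝 1)) (hbot : Tendsto f atBot (𝓝 (-1))) :
    ENNReal.ofReal (Cstar F) + ∫⁻ x, ENNReal.ofReal (1 / 2 * sqDefect (signedRoot F) f x) ≤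
      ∫⁻ x, ENNReal.ofReal (1 / 2 * deriv f x ^ 2 + F (f x)) := by
  set s := signedRoot F
  have hs : Continuous s := hF.continuous_signedRoot
  have hFc : Continuous F := hF.differentiable.continuous
  by_cases hfin : ∫⁻ x, ENNReal.ofReal (1 / 2 * deriv f x ^ 2 + F (f x)) = ⊤
  · rw [hfin]; exact le_top
  set φ : ℝ → ℝ := fun x => 1 / 2 * deriv f x ^ 2 + F (f x) with hφ
  have hφnn : ∀ x, 0 ≤ φ x := fun x => by
    have := hF.nonneg (f x); positivity
  have hφm : Measurable φ :=
    (((measurable_deriv f).pow_const 2).const_mul _).add (hFc.comp hf.continuous).measurable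
  have hφi : Integrable φ := by
    refine ⟨hφm.aestronglyMeasurable, ?_⟩
    rw [hasFiniteIntegral_iff_ofReal (ae_of_all _ hφnn)]
    exact lt_top_iff_ne_top.2 hfin
  have hsq : ∀ x, s (f x) ^ 2 = 2 * F (f x) := fun x => hF.signedRoot_sq _
  have hsm : Measurable fun x => s (f x) := (hs.comp hf.continuous).measurable
  have hpi : Integrable fun x => s (f x) * deriv f x := by
    refine hφi.mono' (hsm.mul (measurable_deriv f)).aestronglyMeasurable (ae_of_all _ fun x => ?_)
    rw [Real.norm_eq_abs, abs_le]
    have := hsq x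
    constructor <;> simp only [hφ] <;>
      nlinarith [sq_nonneg (s (f x) - deriv f x), sq_nonneg (s (f x) + deriv f x)]
  have hdec : ∀ x, φ x = 1 / 2 * sqDefect s f x + s (f x) * deriv f x := fun x => by
    have := hsq x
    simp only [hφ, sqDefect]
    linarith
  have hdi : Integrable fun x => 1 / 2 * sqDefect s f x := by
    have : (fun x => 1 / 2 * sqDefect s f x) = fun x => φ x - s (f x) * deriv f x :=
      funext fun x => by rw [hdec]; ring
    rw [this]
    exact hφi.sub hpi
  have hC : ∫ x, s (f x) * deriv f x = Cstar F := by
    set S : ℝ → ℝ := fun u => ∫ v in (0 : ℝ)..u, s v with hSdef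
    have hS : ∀ u, HasDerivAt S (s u) u := fun u =>
      intervalIntegral.integral_hasDerivAt_right (hs.intervalIntegrable _ _)
        (hs.stronglyMeasurableAtFilter _ _) hs.continuousAt
    have hSc : Continuous S := continuous_iff_continuousAt.2 fun u => (hS u).continuousAt
    have hL : LocallyLipschitz (S ∘ f) := (locallyLipschitz_of_hasDerivAt hs hS).comp hf
    have hft : ∀ n : ℕ, ∫ x in (-(n : ℝ))..n, s (f x) * deriv f x = S (f n) - S (f (-n)) :=
      fun n => by
        have h1 := (hL.absolutelyContinuousOnInterval (-(n : ℝ)) n).integral_deriv_eq_sub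
        simp only [Function.comp_apply] at h1
        rw [← h1]
        refine intervalIntegral.integral_congr_ae ?_
        filter_upwards [hf.ae_differentiableAt] with x hfx _
        exact (((hS (f x)).comp x hfx.hasDerivAt).deriv).symm
    have hnat : Tendsto (fun n : ℕ => (n : ℝ)) atTop atTop := tendsto_natCast_atTop_atTop
    have hlim1 := intervalIntegral_tendsto_integral hpi (tendsto_neg_atTop_atBot.comp hnat) hnat
    have hlim2 : Tendsto (fun n : ℕ => S (f n) - S (f (-n))) atTop (𝓝 (S 1 - S (-1))) :=
      ((hSc.tendsto 1).comp (htop.comp hnat)).sub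
        ((hSc.tendsto (-1)).comp (hbot.comp (tendsto_neg_atTop_atBot.comp hnat)))
    have h2 := tendsto_nhds_unique (hlim1.congr fun n => hft n) hlim2
    rw [h2, Cstar, hSdef]
    simp only
    rw [intervalIntegral.integral_interval_sub_left (hs.intervalIntegrable _ _)
      (hs.intervalIntegrable _ _)]
    refine intervalIntegral.integral_congr fun u hu => ?_
    rw [Set.uIcc_of_le (by norm_num)] at hu
    exact signedRoot_of_mem hu
  have hCnn : 0 ≤ Cstar F :=
    intervalIntegral.integral_nonneg (by norm_num) fun u _ => Real.sqrt_nonneg _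
  have hdnn : ∀ x, 0 ≤ 1 / 2 * sqDefect s f x := fun x => by
    have := sqDefect_nonneg s f x; positivity
  rw [← ofReal_integral_eq_lintegral_ofReal hφi (ae_of_all _ hφnn),
    ← ofReal_integral_eq_lintegral_ofReal hdi (ae_of_all _ hdnn),
    ← ENNReal.ofReal_add hCnn (integral_nonneg hdnn)]
  refine ENNReal.ofReal_le_ofReal ?_
  rw [← hC, add_comm, ← integral_add hdi hpi]
  exact (integral_congr_ae (ae_of_all _ fun x => (hdec x).symm)).le

section Segment

variable {V : Type*} [NormedAddCommGroup V] [NormedSpace ℝ V] [FiniteDimensional ℝ V]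
  [MeasurableSpace V] [BorelSpace V] {μ : Measure V} [μ.IsAddHaarMeasure]

theorem lintegral_comp_smul_add {ψ : V → ℝ≥0∞} (hψ : Measurable ψ) {t : ℝ} (ht : t ≠ 0) (c : V) :
    ∫⁻ y, ψ (c + t • y) ∂μ =
      ENNReal.ofReal |(t ^ Module.finrank ℝ V)⁻¹| * ∫⁻ y, ψ y ∂μ := by
  have h := lintegral_map (μ := μ) (hψ.comp (measurable_const_add c)) (measurable_const_smul t)
  simp only [Function.comp_apply] at h
  rw [← h, Measure.map_addHaar_smul μ ht, lintegral_smul_measure,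
    lintegral_add_left_eq_self (fun y => ψ y) c, smul_eq_mul]

theorem Convex.lintegral_segment_le_of_half_le {Y : Set V} (hY : Convex ℝ Y)
    (hYm : MeasurableSet Y) {ψ : V → ℝ≥0∞} (hψ : Measurable ψ) {t : ℝ}
    (ht : t ∈ Set.Icc (1 / 2 : ℝ) 1) {y' : V} (hy' : y' ∈ Y) :
    ∫⁻ y in Y, ψ (y' + t • (y - y')) ∂μ ≤ 2 ^ Module.finrank ℝ V * ∫⁻ y in Y, ψ y ∂μ := by
  have ht0 : 0 < t := by linarith [ht.1]
  have hmeas : Measurable (Y.indicator ψ) := hψ.indicator hYm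
  calc ∫⁻ y in Y, ψ (y' + t • (y - y')) ∂μ
      = ∫⁻ y in Y, Y.indicator ψ (y' + t • (y - y')) ∂μ := by
        refine setLIntegral_congr_fun hYm fun y hy => ?_
        have : y' + t • (y - y') ∈ Y := hY.add_smul_sub_mem hy' hy ⟨ht0.le, ht.2⟩
        simp [Set.indicator_of_mem this]
    _ ≤ ∫⁻ y, Y.indicator ψ (y' + t • (y - y')) ∂μ := setLIntegral_le_lintegral _ _
    _ = ∫⁻ y, Y.indicator ψ ((y' - t • y') + t • y) ∂μ := by
        refine lintegral_congr fun y => ?_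
        congr 1
        rw [smul_sub]; abel
    _ = ENNReal.ofReal |(t ^ Module.finrank ℝ V)⁻¹| * ∫⁻ y in Y, ψ y ∂μ := by
        rw [lintegral_comp_smul_add hmeas ht0.ne', lintegral_indicator hYm]
    _ ≤ _ := by
        gcongr
        rw [abs_of_pos (by positivity), ← inv_pow, ENNReal.ofReal_pow (by positivity)]
        gcongr
        rw [← ENNReal.ofReal_ofNat 2]
        refine ENNReal.ofReal_le_ofReal ?_
        rw [inv_le_comm₀ ht0 two_pos]
        linarith [ht.1]

/-- Averaging over all segments joining two points of a convex set. -/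
theorem Convex.lintegral_segments_le {Y : Set V} (hY : Convex ℝ Y)
    (hYm : MeasurableSet Y) {ψ : V → ℝ≥0∞} (hψ : Measurable ψ) :
    ∫⁻ y' in Y, ∫⁻ y in Y, (∫⁻ t in Set.Ioc (0 : ℝ) 1, ψ (y' + t • (y - y'))) ∂μ ∂μ ≤
      μ Y * (2 ^ Module.finrank ℝ V * ∫⁻ y in Y, ψ y ∂μ) := by
  have hm : Measurable fun p : (V × V) × ℝ => ψ (p.1.1 + p.2 • (p.1.2 - p.1.1)) :=
    hψ.comp (by fun_prop)
  have hslice : ∀ t ∈ Set.Ioc (0 : ℝ) 1,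
      ∫⁻ p, ψ (p.1 + t • (p.2 - p.1)) ∂((μ.restrict Y).prod (μ.restrict Y)) ≤
        μ Y * (2 ^ Module.finrank ℝ V * ∫⁻ y in Y, ψ y ∂μ) := fun t ht => by
    have hmt : Measurable fun p : V × V => ψ (p.1 + t • (p.2 - p.1)) := hψ.comp (by fun_prop)
    rcases le_total (1 / 2) t with h | h
    · rw [lintegral_prod _ hmt.aemeasurable]
      calc ∫⁻ y' in Y, ∫⁻ y in Y, ψ (y' + t • (y - y')) ∂μ ∂μ
          ≤ ∫⁻ y' in Y, 2 ^ Module.finrank ℝ V * ∫⁻ y in Y, ψ y ∂μ ∂μ :=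
            setLIntegral_mono' hYm fun y' hy' =>
              hY.lintegral_segment_le_of_half_le hYm hψ ⟨h, ht.2⟩ hy'
        _ = _ := by rw [setLIntegral_const, mul_comm]
    · rw [lintegral_prod_symm _ hmt.aemeasurable]
      calc ∫⁻ y in Y, ∫⁻ y' in Y, ψ (y' + t • (y - y')) ∂μ ∂μ
          ≤ ∫⁻ y in Y, 2 ^ Module.finrank ℝ V * ∫⁻ y in Y, ψ y ∂μ ∂μ := by
            refine setLIntegral_mono' hYm fun y hy => ?_
            refine le_of_eq_of_le (lintegral_congr fun y' => ?_)
              (hY.lintegral_segment_le_of_half_le hYm hψ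
                (t := 1 - t) ⟨by linarith, by linarith [ht.1]⟩ hy)
            congr 1
            module
        _ = _ := by rw [setLIntegral_const, mul_comm]
  calc ∫⁻ y' in Y, ∫⁻ y in Y, (∫⁻ t in Set.Ioc (0 : ℝ) 1, ψ (y' + t • (y - y'))) ∂μ ∂μ
      = ∫⁻ p, (∫⁻ t in Set.Ioc (0 : ℝ) 1, ψ (p.1 + t • (p.2 - p.1)))
          ∂((μ.restrict Y).prod (μ.restrict Y)) :=
        (lintegral_prod (fun p : V × V => ∫⁻ t in Set.Ioc (0 : ℝ) 1, ψ (p.1 + t • (p.2 - p.1)))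
          hm.lintegral_prod_right'.aemeasurable).symm
    _ = ∫⁻ t in Set.Ioc (0 : ℝ) 1, ∫⁻ p, ψ (p.1 + t • (p.2 - p.1))
          ∂((μ.restrict Y).prod (μ.restrict Y)) := lintegral_lintegral_swap hm.aemeasurable
    _ ≤ ∫⁻ t in Set.Ioc (0 : ℝ) 1, μ Y * (2 ^ Module.finrank ℝ V * ∫⁻ y in Y, ψ y ∂μ) :=
        setLIntegral_mono' measurableSet_Ioc hslice
    _ = _ := by simp

end Segment

/-- The point of `ℝ^(d+1)` with longitudinal coordinate `x` and transversal coordinates `y`. -/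
def pt (d : ℕ) (x : ℝ) (y : Fin d → ℝ) : Eucl d := WithLp.toLp 2 (Fin.cons x y : Fin (d + 1) → ℝ)

/-- The open unit cube, the cross-section of the domain `D`. -/
def unitCube (d : ℕ) : Set (Fin d → ℝ) := Set.univ.pi fun _ => Set.Ioo (0 : ℝ) 1

section Slicing

variable {d : ℕ}

@[simp] theorem pt_zero (x : ℝ) (y : Fin d → ℝ) : pt d x y 0 = x := rfl

@[simp] theorem pt_succ (x : ℝ) (y : Fin d → ℝ) (i : Fin d) : pt d x y i.succ = y i := rfl

theorem pt_mem_domD {x : ℝ} {y : Fin d → ℝ} : pt d x y ∈ domD d ↔ y ∈ unitCube d := by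
  simp [domD, unitCube]

theorem pt_eq_add_smul_single (x : ℝ) (y : Fin d → ℝ) :
    pt d x y = pt d 0 y + x • EuclideanSpace.single 0 1 := by
  ext i
  refine Fin.cases ?_ (fun j => ?_) i <;> simp

theorem pt_add_smul_sub (x t : ℝ) (y y' : Fin d → ℝ) :
    pt d x (y' + t • (y - y')) = pt d x y' + t • pt d 0 (y - y') := by
  ext i
  refine Fin.cases ?_ (fun j => ?_) i <;> simp

theorem norm_pt_sub_sq_le {y y' : Fin d → ℝ} (hy : y ∈ unitCube d) (hy' : y' ∈ unitCube d) :
    ‖pt d 0 (y - y')‖ ^ 2 ≤ d := by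
  rw [EuclideanSpace.norm_sq_eq, Fin.sum_univ_succ]
  have : ∀ i : Fin d, ‖pt d 0 (y - y') i.succ‖ ^ 2 ≤ 1 := fun i => by
    have h1 := hy i trivial
    have h2 := hy' i trivial
    rw [pt_succ, Real.norm_eq_abs, sq_abs, Pi.sub_apply]
    nlinarith [h1.1, h1.2, h2.1, h2.2]
  calc _ ≤ ‖pt d 0 (y - y') 0‖ ^ 2 + ∑ i : Fin d, (1 : ℝ) := by gcongr; exact this _
    _ = d := by simp

theorem convex_unitCube : Convex ℝ (unitCube d) := convex_pi fun _ _ => convex_Ioo _ _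

theorem measurableSet_unitCube : MeasurableSet (unitCube d) :=
  MeasurableSet.univ_pi fun _ => measurableSet_Ioo

theorem volume_unitCube : volume (unitCube d) = 1 := by
  simp [unitCube, volume_pi_pi]

theorem measurePreserving_pt : MeasurePreserving (fun p : ℝ × (Fin d → ℝ) => pt d p.1 p.2) := by
  have h := (volume_preserving_piFinSuccAbove (fun _ : Fin (d + 1) => ℝ) 0).symm
  have heq : ((MeasurableEquiv.piFinSuccAbove (fun _ : Fin (d + 1) => ℝ) 0).symm : _ → _) =
      fun p : ℝ × (Fin d → ℝ) => (Fin.cons p.1 p.2 : Fin (d + 1) → ℝ) := by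
    funext p
    simp [MeasurableEquiv.piFinSuccAbove_symm_apply, Fin.insertNthEquiv]
  rw [heq] at h
  exact (PiLp.volume_preserving_toLp (Fin (d + 1))).comp h

theorem lintegral_domD {φ : Eucl d → ℝ≥0∞} (hφ : Measurable φ) :
    ∫⁻ z in domD d, φ z = ∫⁻ y in unitCube d, ∫⁻ x, φ (pt d x y) := by
  have hpre : (fun p : ℝ × (Fin d → ℝ) => pt d p.1 p.2) ⁻¹' domD d = Set.univ ×ˢ unitCube d := by
    ext p; simp [pt_mem_domD]
  have hD : MeasurableSet (domD d) := by
    have : domD d = ⋂ i : Fin d, (fun z : Eucl d => z i.succ) ⁻¹' Set.Ioo 0 1 := by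
      ext z; simp [domD]
    rw [this]
    exact MeasurableSet.iInter fun i => measurableSet_Ioo.preimage (by fun_prop)
  rw [← measurePreserving_pt.setLIntegral_comp_preimage hD hφ, hpre, Measure.volume_eq_prod,
    ← Measure.prod_restrict, Measure.restrict_univ]
  exact lintegral_prod_symm _ (hφ.comp measurePreserving_pt.measurable).aemeasurable

theorem ae_ae_pt {p : Eucl d → Prop} (hp : ∀ᵐ z, p z) : ∀ᵐ y, ∀ᵐ x, p (pt d x y) :=
  Measure.ae_ae_of_ae_prod (p := fun q : (Fin d → ℝ) × ℝ => p (pt d q.2 q.1))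
    ((measurePreserving_pt.comp
      (Measure.measurePreserving_swap (μ := volume) (ν := volume))).quasiMeasurePreserving.ae hp)

theorem LocallyLipschitz.slice {h : Eucl d → ℝ} (hh : LocallyLipschitz h) (z w : Eucl d) :
    LocallyLipschitz fun t : ℝ => h (z + t • w) := by
  have : LocallyLipschitz fun t : ℝ => z + t • w :=
    ContDiff.locallyLipschitz (𝕂 := ℝ) (by fun_prop)
  exact hh.comp this

theorem LocallyLipschitz.slice_pt {h : Eucl d → ℝ} (hh : LocallyLipschitz h) (y : Fin d → ℝ) :
    LocallyLipschitz fun x : ℝ => h (pt d x y) := by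
  simpa only [← pt_eq_add_smul_single] using hh.slice (pt d 0 y) (EuclideanSpace.single 0 1)

theorem hasDerivAt_slice {h : Eucl d → ℝ} {z w : Eucl d} {t : ℝ}
    (hh : DifferentiableAt ℝ h (z + t • w)) :
    HasDerivAt (fun t : ℝ => h (z + t • w)) (fderiv ℝ h (z + t • w) w) t := by
  have : HasDerivAt (fun t : ℝ => z + t • w) w t := by
    simpa using ((hasDerivAt_id t).smul_const w).const_add z
  exact hh.hasFDerivAt.comp_hasDerivAt t this

theorem deriv_slice_pt {h : Eucl d → ℝ} {x : ℝ} {y : Fin d → ℝ}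
    (hh : DifferentiableAt ℝ h (pt d x y)) :
    deriv (fun x => h (pt d x y)) x = fderiv ℝ h (pt d x y) (EuclideanSpace.single 0 1) := by
  rw [pt_eq_add_smul_single] at hh ⊢
  rw [← (hasDerivAt_slice hh).deriv]
  simp only [← pt_eq_add_smul_single]

end Slicing

section TransversalGradient

theorem ContinuousLinearMap.sq_apply_le_of_inner_eq_zero {E : Type*} [NormedAddCommGroup E]
    [InnerProductSpace ℝ E] (L : E →L[ℝ] ℝ) {e w : E} (he : ‖e‖ = 1) (hew : ⟪e, w⟫ = 0) :
    L w ^ 2 ≤ (‖L‖ ^ 2 - L e ^ 2) * ‖w‖ ^ 2 := by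
  set S := L e ^ 2 * ‖w‖ ^ 2 + L w ^ 2 with hS
  set v := (L e * ‖w‖ ^ 2) • e + L w • w with hv
  have hLv : L v = S := by
    rw [hv, map_add, map_smul, map_smul, smul_eq_mul, smul_eq_mul, hS]; ring
  have hnv : ‖v‖ ^ 2 = ‖w‖ ^ 2 * S := by
    rw [hv, norm_add_sq_real, norm_smul, norm_smul, inner_smul_left, inner_smul_right, hew, he,
      Real.norm_eq_abs, Real.norm_eq_abs, mul_pow, mul_pow, sq_abs, sq_abs, hS]
    simp
    ring
  have hle : S ^ 2 ≤ ‖L‖ ^ 2 * (‖w‖ ^ 2 * S) := by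
    rw [← hnv, ← mul_pow, ← hLv, ← sq_abs]
    exact pow_le_pow_left₀ (abs_nonneg _) (L.le_opNorm v) 2
  have hSnn : 0 ≤ S := by positivity
  rcases hSnn.eq_or_lt with h0 | h0
  · have h1 : L w = 0 := by
      have : L w ^ 2 = 0 := by nlinarith [sq_nonneg (L w), mul_nonneg (sq_nonneg (L e)) (sq_nonneg ‖w‖)]
      exact pow_eq_zero_iff (two_ne_zero) |>.1 this
    have h2 : L e ^ 2 * ‖w‖ ^ 2 = 0 := by rw [h1] at hS; linarith
    rw [h1, sub_mul, h2, sub_zero, zero_pow two_ne_zero]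
    positivity
  · have : S ≤ ‖L‖ ^ 2 * ‖w‖ ^ 2 := by
      refine le_of_mul_le_mul_right ?_ h0
      linarith
    linarith

variable {d : ℕ}

/-- The squared norm of the gradient of `h` transversal to the first coordinate direction. -/
def transversalSq (h : Eucl d → ℝ) (z : Eucl d) : ℝ :=
  ‖fderiv ℝ h z‖ ^ 2 - fderiv ℝ h z (EuclideanSpace.single 0 1) ^ 2

theorem transversalSq_nonneg (h : Eucl d → ℝ) (z : Eucl d) : 0 ≤ transversalSq h z := by
  have h1 := (fderiv ℝ h z).le_opNorm (EuclideanSpace.single 0 1)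
  have h2 : ‖(EuclideanSpace.single 0 1 : Eucl d)‖ = 1 := by simp
  rw [h2, mul_one] at h1
  rw [transversalSq, sub_nonneg, ← sq_abs]
  exact pow_le_pow_left₀ (abs_nonneg _) h1 2

theorem measurable_transversalSq (h : Eucl d → ℝ) : Measurable (transversalSq h) :=
  ((measurable_fderiv ℝ h).norm.pow_const 2).sub ((measurable_fderiv_apply_const ℝ h _).pow_const 2)

theorem sq_fderiv_apply_le_transversalSq (h : Eucl d → ℝ) (z : Eucl d) {w : Eucl d}
    (hw : w 0 = 0) : fderiv ℝ h z w ^ 2 ≤ transversalSq h z * ‖w‖ ^ 2 := by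
  refine (fderiv ℝ h z).sq_apply_le_of_inner_eq_zero (by simp) ?_
  simp [EuclideanSpace.inner_single_left, hw]

open Classical in
/-- The transversal Dirichlet density, set to infinity where `h` is not differentiable. -/
def transversalDensity (h : Eucl d → ℝ) (z : Eucl d) : ℝ≥0∞ :=
  if DifferentiableAt ℝ h z then ENNReal.ofReal (transversalSq h z) else ⊤

theorem measurable_transversalDensity (h : Eucl d → ℝ) : Measurable (transversalDensity h) :=
  Measurable.ite (measurableSet_of_differentiableAt ℝ h)
    (measurable_transversalSq h).ennreal_ofReal measurable_const

theorem LocallyLipschitz.ofReal_sub_sq_le_transversalDensity {h : Eucl d → ℝ}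
    (hh : LocallyLipschitz h) (z : Eucl d) {w : Eucl d} (hw : w 0 = 0) :
    ENNReal.ofReal ((h (z + w) - h z) ^ 2) ≤
      ENNReal.ofReal (‖w‖ ^ 2) * ∫⁻ t in Set.Ioc (0 : ℝ) 1, transversalDensity h (z + t • w) := by
  rcases eq_or_ne w 0 with rfl | hw0
  · simp
  have hpos : 0 < ‖w‖ ^ 2 := by positivity
  by_cases hfin : ∫⁻ t in Set.Ioc (0 : ℝ) 1, transversalDensity h (z + t • w) = ⊤
  · rw [hfin, ENNReal.mul_top (ENNReal.ofReal_pos.2 hpos).ne']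
    exact le_top
  have hm : Measurable fun t : ℝ => transversalDensity h (z + t • w) :=
    (measurable_transversalDensity h).comp (by fun_prop)
  have h1 := (hh.slice z w).ofReal_sub_sq_le_lintegral
  simp only [one_smul, zero_smul, add_zero] at h1
  refine h1.trans ?_
  rw [← lintegral_const_mul _ hm]
  refine lintegral_mono_ae ?_
  filter_upwards [ae_lt_top hm hfin] with t ht
  have hd : DifferentiableAt ℝ h (z + t • w) := by
    by_contra hnd
    simp [transversalDensity, hnd] at ht
  rw [(hasDerivAt_slice hd).deriv, transversalDensity, if_pos hd, ← ENNReal.ofReal_mul hpos.le,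
    mul_comm]
  exact ENNReal.ofReal_le_ofReal (sq_fderiv_apply_le_transversalSq h _ hw)

end TransversalGradient

section Energy

variable {d : ℕ} {F : ℝ → ℝ} {h : Eucl d → ℝ}

/-- The longitudinal part of the energy density, after completing the square. -/
def longitudinalDefect (F : ℝ → ℝ) (h : Eucl d → ℝ) (z : Eucl d) : ℝ≥0∞ :=
  ENNReal.ofReal (1 / 2 * (fderiv ℝ h z (EuclideanSpace.single 0 1) - signedRoot F (h z)) ^ 2)

theorem measurable_longitudinalDefect (hF : IsStdPotential F) (hh : LocallyLipschitz h) :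
    Measurable (longitudinalDefect F h) := by
  have h1 : Measurable fun z => signedRoot F (h z) :=
    (hF.continuous_signedRoot.comp hh.continuous).measurable
  exact ((((measurable_fderiv_apply_const ℝ h _).sub h1).pow_const 2).const_mul _).ennreal_ofReal

theorem tendsto_slice_of_BCpm (hbc : BCpm d h) {y : Fin d → ℝ} (hy : y ∈ unitCube d) :
    Tendsto (fun x => h (pt d x y)) atTop (𝓝 1) ∧
      Tendsto (fun x => h (pt d x y)) atBot (𝓝 (-1)) := by
  simpa only [← pt_eq_add_smul_single] using hbc (pt d 0 y) (pt_mem_domD.2 hy)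

theorem IsStdPotential.add_lintegral_le_eEnergyD (hF : IsStdPotential F)
    (hh : LocallyLipschitz h) (hbc : BCpm d h) :
    ENNReal.ofReal (Cstar F) + (∫⁻ z in domD d, longitudinalDefect F h z +
      ENNReal.ofReal (1 / 2) * transversalDensity h z) ≤ eEnergyD d F h := by
  have hg := measurable_longitudinalDefect hF hh
  have hdiff : ∀ᵐ z : Eucl d, DifferentiableAt ℝ h z := hh.ae_differentiableAt
  have hFh : Measurable fun z => F (h z) :=
    (hF.differentiable.continuous.comp hh.continuous).measurable
  set A : Eucl d → ℝ≥0∞ := fun z =>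
    ENNReal.ofReal (1 / 2 * fderiv ℝ h z (EuclideanSpace.single 0 1) ^ 2 + F (h z)) with hA
  have hAm : Measurable A :=
    ((((measurable_fderiv_apply_const ℝ h _).pow_const 2).const_mul _).add hFh).ennreal_ofReal
  have hE : eEnergyD d F h =
      ∫⁻ z in domD d, (A z + ENNReal.ofReal (1 / 2) * transversalDensity h z) := by
    refine lintegral_congr_ae (ae_restrict_of_ae ?_)
    filter_upwards [hdiff] with z hz
    have h1 := transversalSq_nonneg h z
    have h2 := hF.nonneg (h z)
    simp only [hA, transversalDensity, if_pos hz]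
    rw [← ENNReal.ofReal_mul (by norm_num), ← ENNReal.ofReal_add (by positivity) (by positivity)]
    congr 1
    rw [transversalSq]
    ring
  rw [hE, lintegral_add_left hg, lintegral_add_left hAm, ← add_assoc]
  gcongr
  rw [lintegral_domD hg, lintegral_domD hAm]
  have hslice : ∀ᵐ y, y ∈ unitCube d →
      ENNReal.ofReal (Cstar F) + ∫⁻ x, longitudinalDefect F h (pt d x y) ≤
        ∫⁻ x, A (pt d x y) := by
    filter_upwards [ae_ae_pt hdiff] with y hy hyY
    obtain ⟨htop, hbot⟩ := tendsto_slice_of_BCpm hbc hyY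
    refine le_of_eq_of_le ?_ ((hF.ofReal_Cstar_add_le (hh.slice_pt y) htop hbot).trans_eq ?_)
    · congr 1
      refine lintegral_congr_ae ?_
      filter_upwards [hy] with x hx
      rw [longitudinalDefect, sqDefect, deriv_slice_pt hx]
    · refine lintegral_congr_ae ?_
      filter_upwards [hy] with x hx
      rw [hA, deriv_slice_pt hx]
  calc ENNReal.ofReal (Cstar F) + ∫⁻ y in unitCube d, ∫⁻ x, longitudinalDefect F h (pt d x y)
      = ∫⁻ y in unitCube d,
          (ENNReal.ofReal (Cstar F) + ∫⁻ x, longitudinalDefect F h (pt d x y)) := by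
        rw [lintegral_add_left measurable_const, setLIntegral_const, volume_unitCube, mul_one]
    _ ≤ _ := lintegral_mono_ae ((ae_restrict_iff' measurableSet_unitCube).2 hslice)

/-- There is a good slice: it is close to the average slice, and its own defect is small. -/
theorem IsStdPotential.exists_good_slice (hF : IsStdPotential F) (hh : LocallyLipschitz h) :
    ∃ y' ∈ unitCube d,
      (∫⁻ x, ENNReal.ofReal (sqDefect (signedRoot F) (fun x => h (pt d x y')) x)) ≤
        2 ^ (d + 2) * (∫⁻ z in domD d, longitudinalDefect F h z +
          ENNReal.ofReal (1 / 2) * transversalDensity h z) ∧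
      (∫⁻ y in unitCube d, ∫⁻ x, ENNReal.ofReal ((h (pt d x y) - h (pt d x y')) ^ 2)) ≤
        d * (2 ^ (d + 1) * (∫⁻ z in domD d, longitudinalDefect F h z +
          ENNReal.ofReal (1 / 2) * transversalDensity h z)) := by
  have hg := measurable_longitudinalDefect hF hh
  have hq := measurable_transversalDensity h
  have hptm : Measurable fun p : ℝ × (Fin d → ℝ) => pt d p.1 p.2 := measurePreserving_pt.measurable
  have hdiff : ∀ᵐ z : Eucl d, DifferentiableAt ℝ h z := hh.ae_differentiableAt
  set I := ∫⁻ z in domD d, longitudinalDefect F h z +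
    ENNReal.ofReal (1 / 2) * transversalDensity h z with hI
  set g : (Fin d → ℝ) → ℝ≥0∞ := fun y => ∫⁻ x, longitudinalDefect F h (pt d x y) with hgdef
  set ψ : (Fin d → ℝ) → ℝ≥0∞ := fun y => ∫⁻ x, transversalDensity h (pt d x y) with hψdef
  set J : (Fin d → ℝ) → ℝ≥0∞ := fun y' =>
    ∫⁻ y in unitCube d, (∫⁻ t in Set.Ioc (0 : ℝ) 1, ψ (y' + t • (y - y'))) with hJdef
  have hgm : Measurable g := (hg.comp hptm).lintegral_prod_left'
  have hψm : Measurable ψ := (hq.comp hptm).lintegral_prod_left'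
  have hJm : Measurable J := by
    have h1 : Measurable fun p : ((Fin d → ℝ) × (Fin d → ℝ)) × ℝ =>
        ψ (p.1.1 + p.2 • (p.1.2 - p.1.1)) := hψm.comp (by fun_prop)
    exact Measurable.lintegral_prod_right' (f := fun p : (Fin d → ℝ) × (Fin d → ℝ) =>
      ∫⁻ t in Set.Ioc (0 : ℝ) 1, ψ (p.1 + t • (p.2 - p.1))) h1.lintegral_prod_right'
  have hhalf : (2 : ℝ≥0∞) * ENNReal.ofReal (1 / 2) = 1 := by
    rw [← ENNReal.ofReal_ofNat 2, ← ENNReal.ofReal_mul (by norm_num)]; norm_num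
  have hIeq : I = (∫⁻ y in unitCube d, g y) +
      ENNReal.ofReal (1 / 2) * ∫⁻ y in unitCube d, ψ y := by
    rw [hI, lintegral_add_left hg, lintegral_const_mul _ hq, lintegral_domD hg, lintegral_domD hq]
  have hJle : ∫⁻ y' in unitCube d, J y' ≤ 2 ^ d * ∫⁻ y in unitCube d, ψ y := by
    have := convex_unitCube.lintegral_segments_le (μ := volume) measurableSet_unitCube hψm
    rwa [volume_unitCube, one_mul, Module.finrank_fin_fun] at this
  have htotal : ∫⁻ y' in unitCube d, (J y' + g y') ≤ 2 ^ (d + 1) * I := by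
    rw [lintegral_add_left hJm, hIeq, mul_add, add_comm, ← mul_assoc]
    refine add_le_add (le_mul_of_one_le_left' (one_le_pow₀ one_le_two)) (hJle.trans_eq ?_)
    rw [pow_succ, mul_assoc, mul_assoc, ← mul_assoc 2, hhalf, one_mul]
  have : IsProbabilityMeasure (volume.restrict (unitCube d)) := ⟨by simp [volume_unitCube]⟩
  have hN : ∀ᵐ y ∂volume.restrict (unitCube d),
      y ∈ unitCube d ∧ ∀ᵐ x, DifferentiableAt ℝ h (pt d x y) :=
    (ae_restrict_mem measurableSet_unitCube).and (ae_restrict_of_ae (ae_ae_pt hdiff))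
  obtain ⟨y', hy'N, hy'⟩ := exists_notMem_null_le_lintegral (hJm.add hgm).aemeasurable
    (ae_iff.1 hN)
  obtain ⟨hy'Y, hy'd⟩ := not_not.1 hy'N
  have hbound : J y' + g y' ≤ 2 ^ (d + 1) * I := hy'.trans htotal
  refine ⟨y', hy'Y, ?_, ?_⟩
  · have h1 : ∫⁻ x, ENNReal.ofReal (sqDefect (signedRoot F) (fun x => h (pt d x y')) x) =
        2 * g y' := by
      have hm : Measurable fun x => longitudinalDefect F h (pt d x y') :=
        hg.comp (hptm.comp (measurable_id.prodMk measurable_const))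
      rw [← lintegral_const_mul _ hm]
      refine lintegral_congr_ae ?_
      filter_upwards [hy'd] with x hx
      rw [longitudinalDefect, sqDefect, deriv_slice_pt hx, ENNReal.ofReal_mul (by norm_num),
        ← mul_assoc, hhalf, one_mul]
    rw [h1, pow_succ _ (d + 1), mul_comm _ (2 : ℝ≥0∞), mul_assoc]
    gcongr
    exact le_add_self.trans hbound
  · refine le_trans ?_ (mul_le_mul_right (le_self_add.trans hbound) _)
    have hstep : ∀ y ∈ unitCube d,
        ∫⁻ x, ENNReal.ofReal ((h (pt d x y) - h (pt d x y')) ^ 2) ≤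
          d * ∫⁻ t in Set.Ioc (0 : ℝ) 1, ψ (y' + t • (y - y')) := fun y hy => by
      have hm : Measurable fun p : ℝ × ℝ =>
          transversalDensity h (pt d p.1 (y' + p.2 • (y - y'))) :=
        hq.comp (hptm.comp (by fun_prop : Measurable fun p : ℝ × ℝ =>
          ((p.1, y' + p.2 • (y - y')) : ℝ × (Fin d → ℝ))))
      calc ∫⁻ x, ENNReal.ofReal ((h (pt d x y) - h (pt d x y')) ^ 2)
          ≤ ∫⁻ x, d * ∫⁻ t in Set.Ioc (0 : ℝ) 1,
              transversalDensity h (pt d x (y' + t • (y - y'))) := by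
            refine lintegral_mono fun x => ?_
            have h1 := hh.ofReal_sub_sq_le_transversalDensity (pt d x y')
              (w := pt d 0 (y - y')) (pt_zero _ _)
            have h2 : pt d x y = pt d x y' + pt d 0 (y - y') := by
              simpa using pt_add_smul_sub x 1 y y'
            simp only [← h2, ← pt_add_smul_sub] at h1
            refine h1.trans ?_
            gcongr
            rw [← ENNReal.ofReal_natCast]
            exact ENNReal.ofReal_le_ofReal (norm_pt_sub_sq_le hy hy'Y)
        _ = d * ∫⁻ x, ∫⁻ t in Set.Ioc (0 : ℝ) 1,
              transversalDensity h (pt d x (y' + t • (y - y'))) :=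
            lintegral_const_mul _ hm.lintegral_prod_right'
        _ = _ := by rw [lintegral_lintegral_swap hm.aemeasurable]
    refine (setLIntegral_mono' measurableSet_unitCube hstep).trans_eq ?_
    rw [lintegral_const_mul' _ _ (ENNReal.natCast_ne_top d)]

end Energy

/-- Lower bound for the free energy away from the minimizers: there are
`c₀, δ₀ > 0` such that every piecewise differentiable configuration `h` with boundary values
`±1` and `dist_{L²(D)}(h, M) > δ` (where `δ ≤ δ₀`) has free energy `𝓕(h) > c₀ δ²`. -/
theorem statement7 (d : ℕ) (F m : ℝ → ℝ) (hF : IsStdPotential F) (hm : IsProfile F m) :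
    ∃ c₀ δ₀ : ℝ, 0 < c₀ ∧ 0 < δ₀ ∧
      ∀ δ : ℝ, 0 < δ → δ ≤ δ₀ →
        ∀ h : Eucl d → ℝ, LocallyLipschitz h → BCpm d h →
          ENNReal.ofReal δ < eDistM d m h →
          ENNReal.ofReal (Cstar F + c₀ * δ ^ 2) < eEnergyD d F h := by
  obtain ⟨r, κ, Λ, H⟩ := hF.exists_isForwardStable
  obtain ⟨e₀, C, he₀, hC, hstab⟩ := H.exists_stability hF.signedRoot_neg hm.isConnection
    fun u hu => by rw [signedRoot_of_mem hu]; exact Real.sqrt_nonneg _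
  set A : ℝ := 2 * d + 4 * C + 2 with hA
  have hA2 : 2 ≤ A := by
    have : (0 : ℝ) ≤ d := d.cast_nonneg
    linarith
  set K : ℝ := 2 ^ (d + 1) with hK
  have hKpos : 0 < K := by positivity
  have hCnn : 0 ≤ Cstar F :=
    intervalIntegral.integral_nonneg (by norm_num) fun u _ => Real.sqrt_nonneg _
  refine ⟨1 / (A * K), min 1 e₀, by positivity, by positivity, fun δ hδ hδ₀ h hh hbc hdist => ?_⟩
  by_contra! hE
  refine absurd hdist (not_lt.2 ?_)
  set s := signedRoot F with hs
  set e : ℝ := δ ^ 2 / A with he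
  have hepos : 0 ≤ e := by positivity
  have hAe : A * e = δ ^ 2 := by rw [he]; field_simp
  have hKe : K * (1 / (A * K) * δ ^ 2) = e := by rw [he]; field_simp
  have hI := (ENNReal.add_le_add_iff_left ENNReal.ofReal_ne_top).1
    (((hF.add_lintegral_le_eEnergyD hh hbc).trans hE).trans_eq
      (ENNReal.ofReal_add hCnn (by positivity)))
  have hKI : 2 ^ (d + 1) * (∫⁻ z in domD d, longitudinalDefect F h z +
      ENNReal.ofReal (1 / 2) * transversalDensity h z) ≤ ENNReal.ofReal e := by
    rw [← hKe, ENNReal.ofReal_mul hKpos.le, hK, ENNReal.ofReal_pow zero_le_two,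
      ENNReal.ofReal_ofNat]
    gcongr
  obtain ⟨y', hy', hdef, hJ⟩ := hF.exists_good_slice hh
  set f : ℝ → ℝ := fun x => h (pt d x y') with hf
  have hfL : LocallyLipschitz f := hh.slice_pt y'
  have hJe : ∫⁻ y in unitCube d, ∫⁻ x, ENNReal.ofReal ((h (pt d x y) - f x) ^ 2) ≤
      ENNReal.ofReal (d * e) := by
    rw [ENNReal.ofReal_mul d.cast_nonneg, ENNReal.ofReal_natCast]
    exact hJ.trans (mul_le_mul_right hKI _)
  have hdefe : ∫⁻ x, ENNReal.ofReal (sqDefect s f x) ≤ ENNReal.ofReal (2 * e) := by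
    rw [ENNReal.ofReal_mul zero_le_two, ENNReal.ofReal_ofNat]
    refine hdef.trans ?_
    rw [pow_succ _ (d + 1), mul_comm _ (2 : ℝ≥0∞), mul_assoc]
    gcongr
  have hdm : Measurable (sqDefect s f) :=
    ((measurable_deriv f).sub
      (hF.continuous_signedRoot.comp hfL.continuous).measurable).pow_const 2
  have hdi : Integrable (sqDefect s f) := by
    refine ⟨hdm.aestronglyMeasurable, ?_⟩
    rw [hasFiniteIntegral_iff_ofReal (ae_of_all _ (sqDefect_nonneg s f))]
    exact hdefe.trans_lt ENNReal.ofReal_lt_top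
  have hInt : ∫ x, sqDefect s f x ≤ 2 * e := by
    rw [← ofReal_integral_eq_lintegral_ofReal hdi (ae_of_all _ (sqDefect_nonneg s f))] at hdefe
    exact (ENNReal.ofReal_le_ofReal_iff (by positivity)).1 hdefe
  have hsmall : 2 * e ≤ e₀ := by
    have h1 : δ ≤ 1 := hδ₀.trans (min_le_left _ _)
    have h2 : δ ≤ e₀ := hδ₀.trans (min_le_right _ _)
    nlinarith
  obtain ⟨htop, hbot⟩ := tendsto_slice_of_BCpm hbc hy'
  obtain ⟨ξ, hξ⟩ := hstab f hfL htop hbot hdi (hInt.trans hsmall)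
  have hmc : Continuous m := hm.isConnection.continuous
  have hmeas : Measurable fun z : Eucl d => ENNReal.ofReal ((h z - m (z 0 - ξ)) ^ 2) := by
    have h1 : Continuous fun z : Eucl d => m (z 0 - ξ) := hmc.comp (by fun_prop)
    exact (((hh.continuous.sub h1).pow 2).measurable).ennreal_ofReal
  have hfm : Measurable fun x => ENNReal.ofReal (2 * (f x - m (x - ξ)) ^ 2) := by
    have h1 : Continuous fun x => m (x - ξ) := hmc.comp (by fun_prop)
    have h2 : Continuous f := hfL.continuous
    have h3 : Continuous fun x => 2 * (f x - m (x - ξ)) ^ 2 := by fun_prop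
    exact h3.measurable.ennreal_ofReal
  have hfξ : ∫⁻ x, ENNReal.ofReal (2 * (f x - m (x - ξ)) ^ 2) ≤
      ENNReal.ofReal (4 * C * e) := by
    simp_rw [ENNReal.ofReal_mul (zero_le_two (α := ℝ))]
    rw [lintegral_const_mul' _ _ ENNReal.ofReal_ne_top]
    calc _ ≤ ENNReal.ofReal 2 * ENNReal.ofReal (C * (2 * e)) := by
          gcongr
          exact hξ.trans (ENNReal.ofReal_le_ofReal (mul_le_mul_of_nonneg_left hInt hC))
      _ = _ := by
          rw [← ENNReal.ofReal_mul zero_le_two]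
          congr 1; ring
  have hsq : ∫⁻ z in domD d, ENNReal.ofReal ((h z - m (z 0 - ξ)) ^ 2) ≤
      ENNReal.ofReal (δ ^ 2) := by
    rw [lintegral_domD hmeas]
    calc ∫⁻ y in unitCube d, ∫⁻ x, ENNReal.ofReal ((h (pt d x y) - m (x - ξ)) ^ 2)
        ≤ ∫⁻ y in unitCube d, (ENNReal.ofReal 2 *
            (∫⁻ x, ENNReal.ofReal ((h (pt d x y) - f x) ^ 2)) + ENNReal.ofReal (4 * C * e)) := by
          refine lintegral_mono fun y => le_trans ?_ (add_le_add_right hfξ _)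
          rw [← lintegral_const_mul' _ _ ENNReal.ofReal_ne_top, ← lintegral_add_right _ hfm]
          refine lintegral_mono fun x => ?_
          rw [← ENNReal.ofReal_mul zero_le_two, ← ENNReal.ofReal_add (by positivity) (by positivity)]
          refine ENNReal.ofReal_le_ofReal ?_
          nlinarith [sq_nonneg ((h (pt d x y) - f x) - (f x - m (x - ξ)))]
      _ = ENNReal.ofReal 2 *
            (∫⁻ y in unitCube d, ∫⁻ x, ENNReal.ofReal ((h (pt d x y) - f x) ^ 2)) +
            ENNReal.ofReal (4 * C * e) := by
          rw [lintegral_add_right _ measurable_const,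
            lintegral_const_mul' _ _ ENNReal.ofReal_ne_top, setLIntegral_const, volume_unitCube,
            mul_one]
      _ ≤ ENNReal.ofReal 2 * ENNReal.ofReal (d * e) + ENNReal.ofReal (4 * C * e) := by gcongr
      _ = ENNReal.ofReal (2 * (d * e) + 4 * C * e) := by
          rw [← ENNReal.ofReal_mul zero_le_two, ← ENNReal.ofReal_add (by positivity) (by positivity)]
      _ ≤ ENNReal.ofReal (δ ^ 2) := by
          refine ENNReal.ofReal_le_ofReal ?_
          rw [← hAe, hA]
          nlinarith
  calc eDistM d m h ≤ eL2 d (fun z => h z - m (z 0 - ξ)) := iInf_le _ ξ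
    _ ≤ (ENNReal.ofReal (δ ^ 2)) ^ (1 / 2 : ℝ) := ENNReal.rpow_le_rpow hsq (by norm_num)
    _ = ENNReal.ofReal δ := by
        rw [ENNReal.ofReal_rpow_of_nonneg (by positivity) (by norm_num), ← Real.sqrt_eq_rpow,
          Real.sqrt_sq hδ.le]


end
end
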